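/- arXiv:1509.04990 — 2 statements merged into one kernel-verified Lean document; each statement's English description precedes it below -/
import Mathlib

section
/- Let φ : (C^m,0) → (C^r,0) be a holomorphic map germ, I an ideal of O_r, and J = φ*(I) the ideal generated by the pullbacks of generators of I in O_m. If O_r/I is Cohen-Macaulay and codim V(I) = codim V(J), then O_m/J is Cohen-Macaulay. -/
open Filter Topology

/-- The local ring of germs at `z` of complex-analytic functions, as a subring of the
ring of germs of all functions at `z`. -/
noncomputable def analyticGerms (E : Type*) [NormedAddCommGroup E] [NormedSpace ℂ E]
    (z : E) : Subring (Filter.Germ (nhds z) ℂ) where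
  carrier := {γ | ∃ g : E → ℂ, AnalyticAt ℂ g z ∧ γ = (g : Filter.Germ (nhds z) ℂ)}
  mul_mem' := by rintro a b ⟨g, hg, rfl⟩ ⟨h, hh, rfl⟩; exact ⟨g * h, hg.mul hh, rfl⟩
  one_mem' := ⟨1, analyticAt_const, rfl⟩
  add_mem' := by rintro a b ⟨g, hg, rfl⟩ ⟨h, hh, rfl⟩; exact ⟨g + h, hg.add hh, rfl⟩
  zero_mem' := ⟨0, analyticAt_const, rfl⟩
  neg_mem' := by rintro a ⟨g, hg, rfl⟩; exact ⟨-g, hg.neg, rfl⟩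

/-- A (Noetherian, local) commutative ring is Cohen–Macaulay iff there is a regular
sequence, contained in the Jacobson radical (= the maximal ideal in the local case),
whose length equals the Krull dimension. -/
def IsCohenMacaulayRing (R : Type*) [CommRing R] : Prop :=
  ∃ rs : List R, (∀ r ∈ rs, r ∈ (Ideal.jacobson (⊥ : Ideal R))) ∧
    RingTheory.Sequence.IsRegular R rs ∧ ringKrullDim R = rs.length

section CohenMacaulayIdeals

open IsLocalRing Ideal
open scoped Pointwise

variable {R : Type*} [CommRing R]

/-- `x` is a nonzerodivisor modulo the ideal `K`. -/
def RegularMod (K : Ideal R) (x : R) : Prop := ∀ f, x * f ∈ K → f ∈ K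

/-- The list `rs` is a weakly regular sequence modulo the ideal `K`. -/
def RegularSeqMod : Ideal R → List R → Prop
  | _, [] => True
  | K, x :: xs => RegularMod K x ∧ RegularSeqMod (K ⊔ span {x}) xs

theorem mem_sup_span_singleton {K : Ideal R} {x f : R} :
    f ∈ K ⊔ span {x} ↔ ∃ g, f - x * g ∈ K := by
  rw [Submodule.mem_sup]
  constructor
  · rintro ⟨k, hk, z, hz, rfl⟩
    obtain ⟨g, rfl⟩ := mem_span_singleton'.1 hz
    exact ⟨g, by simpa [mul_comm] using hk⟩
  · rintro ⟨g, hg⟩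
    exact ⟨_, hg, x * g, mem_span_singleton'.2 ⟨g, mul_comm _ _⟩, by ring⟩

theorem RegularMod.swap {K : Ideal R} {x w : R} (hx : RegularMod K x)
    (hw : RegularMod (K ⊔ span {x}) w) : RegularMod (K ⊔ span {w}) x := by
  intro f hf
  obtain ⟨g, hg⟩ := mem_sup_span_singleton.1 hf
  obtain ⟨h, hh⟩ := mem_sup_span_singleton.1
    (hw g (mem_sup_span_singleton.2 ⟨f, by simpa using K.neg_mem hg⟩))
  refine mem_sup_span_singleton.2 ⟨h, hx _ ?_⟩
  have := K.add_mem hg (K.mul_mem_left w hh)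
  convert this using 1; ring

theorem regularMod_iff_isSMulRegular {K : Ideal R} {x : R} :
    RegularMod K x ↔ IsSMulRegular (R ⧸ K) x := by
  rw [isSMulRegular_iff_right_eq_zero_of_smul]
  constructor
  · intro h m hm
    obtain ⟨f, rfl⟩ := Ideal.Quotient.mk_surjective m
    rw [← Ideal.Quotient.mk_eq_mk, ← Submodule.Quotient.mk_smul, Ideal.Quotient.mk_eq_mk,
      Ideal.Quotient.eq_zero_iff_mem] at hm
    exact Ideal.Quotient.eq_zero_iff_mem.2 (h f hm)
  · intro h f hf
    refine Ideal.Quotient.eq_zero_iff_mem.1 (h (Ideal.Quotient.mk K f) ?_)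
    rw [← Ideal.Quotient.mk_eq_mk, ← Submodule.Quotient.mk_smul, Ideal.Quotient.mk_eq_mk,
      Ideal.Quotient.eq_zero_iff_mem]
    exact hf

theorem isWeaklyRegular_iff_regularSeqMod (rs : List R) :
    ∀ {M : Type*} [AddCommGroup M] [Module R M] (f : R →ₗ[R] M), Function.Surjective f →
      (RingTheory.Sequence.IsWeaklyRegular M rs ↔ RegularSeqMod (LinearMap.ker f) rs) := by
  induction rs with
  | nil => intro M _ _ f hf; simp [RegularSeqMod]
  | cons x xs ih =>
    intro M _ _ f hf
    rw [RingTheory.Sequence.isWeaklyRegular_cons_iff, RegularSeqMod]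
    have hker : LinearMap.ker ((Submodule.mkQ (x • (⊤ : Submodule R M))).comp f)
        = LinearMap.ker f ⊔ span {x} := by
      ext a
      rw [mem_sup_span_singleton, LinearMap.mem_ker, LinearMap.comp_apply, Submodule.mkQ_apply,
        Submodule.Quotient.mk_eq_zero, Submodule.mem_smul_pointwise_iff_exists]
      constructor
      · rintro ⟨b, -, hb⟩
        obtain ⟨g, rfl⟩ := hf b
        exact ⟨g, by rw [LinearMap.mem_ker, map_sub, ← smul_eq_mul, map_smul, hb, sub_self]⟩
      · rintro ⟨g, hg⟩
        rw [LinearMap.mem_ker, map_sub, ← smul_eq_mul, map_smul, sub_eq_zero] at hg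
        exact ⟨f g, trivial, hg.symm⟩
    rw [← hker]
    refine and_congr ?_ (ih _ ((Submodule.mkQ_surjective _).comp hf))
    rw [isSMulRegular_iff_right_eq_zero_of_smul]
    constructor
    · intro h a ha
      rw [LinearMap.mem_ker, ← smul_eq_mul, map_smul] at ha
      exact h _ ha
    · intro h b hb
      obtain ⟨g, rfl⟩ := hf b
      exact h g (by rw [LinearMap.mem_ker, ← smul_eq_mul, map_smul, hb])

theorem ringKrullDim_quotient_sup (K : Ideal R) (x : R) :
    ringKrullDim (R ⧸ (K ⊔ span {x}))
      = ringKrullDim ((R ⧸ K) ⧸ span {Ideal.Quotient.mk K x}) := by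
  have := ringKrullDim_eq_of_ringEquiv (DoubleQuot.quotQuotEquivQuotSup K (span {x}))
  rw [Ideal.map_span, Set.image_singleton] at this
  exact this.symm

theorem exists_prime_colon [IsNoetherianRing R] {K : Ideal R} {a : R} (ha : a ∉ K) :
    ∃ p : Ideal R, p.IsPrime ∧ (∃ b, ∀ c, c ∈ p ↔ c * b ∈ K) ∧ ∀ c, c * a ∈ K → c ∈ p := by
  obtain ⟨p, hp, hle⟩ := exists_le_isAssociatedPrime_of_isNoetherianRing R
    (Ideal.Quotient.mk K a) (by rwa [Ne, Ideal.Quotient.eq_zero_iff_mem])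
  have key : ∀ b c : R, c ∈ (⊥ : Submodule R (R ⧸ K)).colon {Ideal.Quotient.mk K b}
      ↔ c * b ∈ K := fun b c => by
    rw [Submodule.mem_colon_singleton, Submodule.mem_bot, ← Ideal.Quotient.mk_eq_mk,
      ← Submodule.Quotient.mk_smul, Ideal.Quotient.mk_eq_mk, Ideal.Quotient.eq_zero_iff_mem,
      smul_eq_mul]
  obtain ⟨hprime, b, hb⟩ := (isAssociatedPrime_iff ..).1 hp
  obtain ⟨b, rfl⟩ := Ideal.Quotient.mk_surjective b
  refine ⟨p, hprime, ⟨b, fun c => ?_⟩, fun c hc => hle ((key a c).2 hc)⟩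
  rw [hb, key]

theorem nontrivial_of_ringKrullDim_eq_natCast {n : ℕ} (h : ringKrullDim R = n) :
    Nontrivial R := by
  by_contra hn
  rw [not_nontrivial_iff_subsingleton] at hn
  rw [ringKrullDim_eq_bot_of_subsingleton] at h
  exact WithBot.bot_ne_coe h

theorem ker_mk_comp_of_surjective {A : Type*} [CommRing A] {ρ : R →+* A}
    (hρ : Function.Surjective ρ) {xs : List R} (hker : RingHom.ker ρ = ofList xs) (K : Ideal R) :
    RingHom.ker ((Ideal.Quotient.mk (K.map ρ)).comp ρ) = K ⊔ ofList xs := by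
  rw [← RingHom.comap_ker, Ideal.mk_ker, Ideal.comap_map_of_surjective' ρ hρ, hker]

variable [IsLocalRing R]

theorem isLocalRing_quotient {K : Ideal R} (hK : K ≠ ⊤) : IsLocalRing (R ⧸ K) :=
  have := Ideal.Quotient.nontrivial_iff.mpr hK
  IsLocalRing.of_surjective' _ Ideal.Quotient.mk_surjective

theorem mk_mem_maximalIdeal {K : Ideal R} [IsLocalRing (R ⧸ K)] {x : R}
    (hx : x ∈ maximalIdeal R) : Ideal.Quotient.mk K x ∈ maximalIdeal (R ⧸ K) := by
  have := ((local_hom_TFAE (Ideal.Quotient.mk K)).out 0 2).1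
    (IsLocalHom.of_surjective _ Ideal.Quotient.mk_surjective)
  exact this (mem_map_of_mem _ hx)

/-- The local ring `R ⧸ K` has a regular sequence of length `n` in its maximal ideal. -/
def HasDepth : Ideal R → ℕ → Prop
  | _, 0 => True
  | K, n + 1 => ∃ x ∈ maximalIdeal R, RegularMod K x ∧ HasDepth (K ⊔ span {x}) n

theorem RegularSeqMod.hasDepth {rs : List R} : ∀ {K : Ideal R}, RegularSeqMod K rs →
    (∀ x ∈ rs, x ∈ maximalIdeal R) → HasDepth K rs.length := by
  induction rs with
  | nil => intros; trivial
  | cons x xs ih =>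
    intro K h hm
    exact ⟨x, hm x (by simp), h.1, ih h.2 fun y hy => hm y (by simp [hy])⟩

theorem HasDepth.exists_regularSeqMod {n : ℕ} : ∀ {K : Ideal R}, HasDepth K n →
    ∃ rs : List R, rs.length = n ∧ (∀ x ∈ rs, x ∈ maximalIdeal R) ∧ RegularSeqMod K rs := by
  induction n with
  | zero => intro K _; exact ⟨[], rfl, by simp, trivial⟩
  | succ n ih =>
    rintro K ⟨x, hx, hreg, h⟩
    obtain ⟨rs, hl, hm, hr⟩ := ih h
    exact ⟨x :: rs, by simp [hl], List.forall_mem_cons.2 ⟨hx, hm⟩, hreg, hr⟩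

theorem isCohenMacaulayRing_iff_hasDepth_ker {Q : Type*} [CommRing Q] [Nontrivial Q]
    {f : R →+* Q} (hf : Function.Surjective f) {d : ℕ} (hd : ringKrullDim Q = d) :
    IsCohenMacaulayRing Q ↔ HasDepth (RingHom.ker f) d := by
  have : IsLocalRing Q := IsLocalRing.of_surjective' f hf
  have : IsLocalHom f := IsLocalHom.of_surjective f hf
  algebraize [f]
  have hker : ∀ rs : List R, RingTheory.Sequence.IsWeaklyRegular Q (rs.map f)
      ↔ RegularSeqMod (RingHom.ker f) rs := fun rs =>
    (RingTheory.Sequence.isWeaklyRegular_map_algebraMap_iff Q Q rs).trans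
      (isWeaklyRegular_iff_regularSeqMod rs (Algebra.linearMap R Q) hf)
  have hmem : ∀ x : R, f x ∈ maximalIdeal Q ↔ x ∈ maximalIdeal R := fun x => by
    rw [mem_maximalIdeal, mem_maximalIdeal, mem_nonunits_iff, mem_nonunits_iff, isUnit_map_iff]
  constructor
  · rintro ⟨rs, hrs, hreg, hdim⟩
    obtain ⟨rs, rfl⟩ := List.map_surjective_iff.2 hf rs
    rw [IsLocalRing.jacobson_eq_maximalIdeal _ bot_ne_top] at hrs
    have hlen : rs.length = d := by
      rw [hd, List.length_map] at hdim
      exact_mod_cast hdim.symm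
    rw [← hlen]
    exact ((hker rs).1 hreg.toIsWeaklyRegular).hasDepth fun x hx =>
      (hmem x).1 (hrs _ (List.mem_map_of_mem hx))
  · intro h
    obtain ⟨rs, hlen, hrs, hreg⟩ := h.exists_regularSeqMod
    have hmax : ∀ x ∈ rs.map f, x ∈ maximalIdeal Q := fun x hx => by
      obtain ⟨y, hy, rfl⟩ := List.mem_map.1 hx
      exact (hmem y).2 (hrs y hy)
    refine ⟨rs.map f, ?_, ?_, by rw [hd, List.length_map, hlen]⟩
    · rwa [IsLocalRing.jacobson_eq_maximalIdeal _ bot_ne_top]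
    · exact .of_isWeaklyRegular_of_mem_maximalIdeal Q hmax ((hker rs).2 hreg)

theorem HasDepth.append {rs : List R} {n : ℕ} : ∀ {K : Ideal R}, RegularSeqMod K rs →
    (∀ x ∈ rs, x ∈ maximalIdeal R) → HasDepth (K ⊔ ofList rs) n →
    HasDepth K (rs.length + n) := by
  induction rs with
  | nil => intro K _ _ h; simpa using h
  | cons x xs ih =>
    intro K h hm hd
    rw [List.length_cons, add_right_comm]
    refine ⟨x, hm x (by simp), h.1, ih h.2 (fun y hy => hm y (by simp [hy])) ?_⟩
    rwa [ofList_cons, ← sup_assoc] at hd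

/-- No element outside of `K` is multiplied into `K` by the maximal ideal. -/
def SocleFree (K : Ideal R) : Prop := ∀ t, (∀ a ∈ maximalIdeal R, a * t ∈ K) → t ∈ K

theorem RegularMod.socleFree {K : Ideal R} {x : R} (hx : RegularMod K x)
    (hm : x ∈ maximalIdeal R) : SocleFree K := fun t ht => hx t (ht x hm)

theorem SocleFree.exchange {K : Ideal R} {x y : R} (hx : RegularMod K x) (hy : RegularMod K y)
    (hxm : x ∈ maximalIdeal R) (h : SocleFree (K ⊔ span {x})) :
    SocleFree (K ⊔ span {y}) := by
  intro t ht
  obtain ⟨s, hs⟩ := mem_sup_span_singleton.1 (ht x hxm)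
  have : s ∈ K ⊔ span {x} := by
    refine h s fun a ha => ?_
    obtain ⟨b, hb⟩ := mem_sup_span_singleton.1 (ht a ha)
    refine mem_sup_span_singleton.2 ⟨b, hy _ ?_⟩
    have := K.sub_mem (K.mul_mem_left x hb) (K.mul_mem_left a hs)
    convert this using 1; ring
  obtain ⟨c, hc⟩ := mem_sup_span_singleton.1 this
  refine mem_sup_span_singleton.2 ⟨c, hx _ ?_⟩
  have := K.add_mem hs (K.mul_mem_left y hc)
  convert this using 1; ring

theorem SocleFree.quotient {K : Ideal R} (h : SocleFree K) (t : R ⧸ K)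
    (ht : ∀ a ∈ maximalIdeal R, a • t = 0) : t = 0 := by
  obtain ⟨f, rfl⟩ := Ideal.Quotient.mk_surjective t
  refine Ideal.Quotient.eq_zero_iff_mem.2 (h f fun a ha => ?_)
  have := ht a ha
  rwa [← Ideal.Quotient.mk_eq_mk, ← Submodule.Quotient.mk_smul, Ideal.Quotient.mk_eq_mk,
    Ideal.Quotient.eq_zero_iff_mem] at this

variable [IsNoetherianRing R]

theorem exists_isSMulRegular_of_socle_eq_zero {M : Type*} [AddCommGroup M] [Module R M]
    [Module.Finite R M] (h : ∀ t : M, (∀ a ∈ maximalIdeal R, a • t = 0) → t = 0) :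
    ∃ w ∈ maximalIdeal R, IsSMulRegular M w := by
  have : Subsingleton ((R ⧸ maximalIdeal R) →ₗ[R] M) := by
    refine subsingleton_of_forall_eq 0 fun f => ?_
    have h1 : f (Ideal.Quotient.mk _ 1) = 0 := by
      refine h _ fun a ha => ?_
      rw [← map_smul, ← Ideal.Quotient.mk_eq_mk, ← Submodule.Quotient.mk_smul,
        Ideal.Quotient.mk_eq_mk, Ideal.Quotient.eq_zero_iff_mem.2, map_zero]
      simpa using ha
    ext
    simpa using h1
  obtain ⟨r, hr, hreg⟩ := IsSMulRegular.subsingleton_linearMap_iff.1 this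
  exact ⟨r, by rwa [Ideal.annihilator_quotient] at hr, hreg⟩

theorem exists_regularMod_three {K₁ K₂ K₃ : Ideal R} (h₁ : SocleFree K₁) (h₂ : SocleFree K₂)
    (h₃ : SocleFree K₃) :
    ∃ w ∈ maximalIdeal R, RegularMod K₁ w ∧ RegularMod K₂ w ∧ RegularMod K₃ w := by
  obtain ⟨w, hw, hreg⟩ := exists_isSMulRegular_of_socle_eq_zero
    (M := (R ⧸ K₁) × (R ⧸ K₂) × (R ⧸ K₃)) (by
      rintro ⟨t₁, t₂, t₃⟩ ht
      have ht₁ := h₁.quotient t₁ fun a ha => congrArg Prod.fst (ht a ha)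
      have ht₂ := h₂.quotient t₂ fun a ha => congrArg (fun p => p.2.1) (ht a ha)
      have ht₃ := h₃.quotient t₃ fun a ha => congrArg (fun p => p.2.2) (ht a ha)
      rw [ht₁, ht₂, ht₃, Prod.mk_zero_zero, Prod.mk_zero_zero])
  rw [isSMulRegular_iff_right_eq_zero_of_smul] at hreg
  simp only [regularMod_iff_isSMulRegular, isSMulRegular_iff_right_eq_zero_of_smul]
  refine ⟨w, hw, fun m hm => ?_, fun m hm => ?_, fun m hm => ?_⟩
  · simpa using hreg (m, 0, 0) (by simp [hm])
  · simpa using hreg (0, m, 0) (by simp [hm])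
  · simpa using hreg (0, 0, m) (by simp [hm])

theorem HasDepth.sup_span_singleton {n : ℕ} : ∀ {K : Ideal R} {y : R}, HasDepth K (n + 1) →
    y ∈ maximalIdeal R → RegularMod K y → HasDepth (K ⊔ span {y}) n := by
  induction n with
  | zero => intros; trivial
  | succ n ih =>
    rintro K y ⟨x, hx, hxK, hd⟩ hy hyK
    have hsx : SocleFree (K ⊔ span {x}) := by
      obtain ⟨w, hw, hwK, -⟩ := hd
      exact hwK.socleFree hw
    obtain ⟨w, hw, hwK, hwx, hwy⟩ := exists_regularMod_three (hxK.socleFree hx) hsx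
      (hsx.exchange hxK hyK hx)
    have h1 : HasDepth (K ⊔ span {w}) (n + 1) := by
      refine ⟨x, hx, hxK.swap hwx, ?_⟩
      rw [sup_right_comm]
      exact ih hd hw hwx
    refine ⟨w, hw, hwy, ?_⟩
    rw [sup_right_comm]
    exact ih h1 hy (hyK.swap hwy)

theorem ringKrullDim_le_sup_span_singleton {K : Ideal R} (hK : K ≠ ⊤) {x : R}
    (hx : x ∈ maximalIdeal R) :
    ringKrullDim (R ⧸ K) ≤ ringKrullDim (R ⧸ (K ⊔ span {x})) + 1 := by
  have := isLocalRing_quotient hK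
  rw [ringKrullDim_quotient_sup]
  have := ringKrullDim_le_ringKrullDim_quotSMulTop_succ (mk_mem_maximalIdeal (K := K) hx)
  have h : span {Ideal.Quotient.mk K x} = Ideal.Quotient.mk K x • (⊤ : Ideal (R ⧸ K)) := by
    simp [← Submodule.ideal_span_singleton_smul]
  rwa [h]

theorem HasDepth.le_ringKrullDim_quotient {n : ℕ} : ∀ {K p : Ideal R}, HasDepth K n →
    p.IsPrime → (∃ b, ∀ c, c ∈ p ↔ c * b ∈ K) → (n : WithBot ℕ∞) ≤ ringKrullDim (R ⧸ p) := by
  induction n with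
  | zero =>
    intro K p _ hp _
    have := Ideal.Quotient.nontrivial_iff.mpr hp.ne_top
    simpa using ringKrullDim_nonneg_of_nontrivial
  | succ n ih =>
    rintro K p ⟨x, hx, hreg, hd⟩ hp ⟨b, hb⟩
    have hbK : b ∉ K := fun h => hp.ne_top ((eq_top_iff_one _).2 ((hb 1).2 (by simpa using h)))
    let N : Ideal R := K.colon (p : Set R)
    have hN : ∀ u, u ∈ N ↔ ∀ c ∈ p, c * u ∈ K := fun u => by
      simp only [N, Submodule.mem_colon, smul_eq_mul, SetLike.mem_coe]
      exact forall₂_congr fun c _ => by rw [mul_comm]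
    have hnle : ¬ N ≤ K ⊔ span {x} := by
      intro hle
      refine hbK (Submodule.le_of_le_smul_of_le_jacobson_bot (I := maximalIdeal R) (N := K)
        (N' := N) (IsNoetherian.noetherian _) (IsLocalRing.maximalIdeal_le_jacobson _) ?_
        ((hN b).2 fun c hc => (hb c).1 hc))
      intro u hu
      obtain ⟨v, hv⟩ := mem_sup_span_singleton.1 (hle hu)
      have hvN : v ∈ N := (hN v).2 fun c hc => hreg _ (by
        have := K.sub_mem ((hN u).1 hu c hc) (K.mul_mem_left c hv)
        convert this using 1; ring)
      rw [← sub_add_cancel u (x * v)]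
      exact add_mem (Ideal.mem_sup_left hv)
        (Ideal.mem_sup_right (Submodule.smul_mem_smul hx hvN))
    obtain ⟨u, huN, hu⟩ := SetLike.not_le_iff_exists.1 hnle
    obtain ⟨q, hq, hqb, hqu⟩ := exists_prime_colon hu
    have hpq : p ≤ q := fun c hc => hqu c (Ideal.mem_sup_left ((hN u).1 huN c hc))
    have hxq : x ∈ q := hqu x (Ideal.mem_sup_right (mem_span_singleton'.2 ⟨u, mul_comm _ _⟩))
    have hxp : x ∉ p := fun h => hbK (hreg _ ((hb x).1 h))
    have hdim : ringKrullDim (R ⧸ q) + 1 ≤ ringKrullDim (R ⧸ p) := by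
      refine ringKrullDim_succ_le_of_surjective (Ideal.Quotient.factor hpq)
        (Ideal.Quotient.factor_surjective hpq) (r := Ideal.Quotient.mk p x) ?_ ?_
      · exact mem_nonZeroDivisors_of_ne_zero (by rwa [Ne, Ideal.Quotient.eq_zero_iff_mem])
      · simpa [Ideal.Quotient.eq_zero_iff_mem] using hxq
    refine le_trans ?_ hdim
    push_cast
    gcongr
    exact ih hd hq hqb

theorem HasDepth.regularMod {n : ℕ} {K : Ideal R} {y : R} (h : HasDepth K n)
    (hy : ringKrullDim (R ⧸ (K ⊔ span {y})) < n) : RegularMod K y := by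
  by_contra hreg
  simp only [RegularMod, not_forall] at hreg
  obtain ⟨f, hyf, hf⟩ := hreg
  obtain ⟨p, hp, ⟨b, hb⟩, hfp⟩ := exists_prime_colon hf
  have hle : K ⊔ span {y} ≤ p := sup_le (fun c hc => (hb c).2 (K.mul_mem_right _ hc))
    ((span_singleton_le_iff_mem _).2 (hfp y hyf))
  refine absurd hy (not_lt.2 ((h.le_ringKrullDim_quotient hp ⟨b, hb⟩).trans ?_))
  exact ringKrullDim_le_of_surjective (Ideal.Quotient.factor hle)
    (Ideal.Quotient.factor_surjective hle)

theorem le_ringKrullDim_sup_ofList_add (ys : List R) : ∀ {K : Ideal R},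
    K ≤ maximalIdeal R → (∀ y ∈ ys, y ∈ maximalIdeal R) →
    ringKrullDim (R ⧸ K) ≤ ringKrullDim (R ⧸ (K ⊔ ofList ys)) + ys.length := by
  induction ys with
  | nil => intro K _ _; rw [ofList_nil, sup_bot_eq]; simp
  | cons y ys ih =>
    intro K hK hm
    have hy := hm y (by simp)
    have h1 := ringKrullDim_le_sup_span_singleton
      (ne_top_of_le_ne_top (maximalIdeal.isMaximal R).ne_top hK) hy
    have h2 := ih (sup_le hK ((span_singleton_le_iff_mem _).2 hy)) fun z hz => hm z (by simp [hz])
    rw [ofList_cons, ← sup_assoc, List.length_cons, Nat.cast_succ, ← add_assoc]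
    exact h1.trans (by gcongr)

theorem HasDepth.sup_ofList (ys : List R) : ∀ {K : Ideal R} {n : ℕ},
    HasDepth K (n + ys.length) → K ≤ maximalIdeal R → (∀ y ∈ ys, y ∈ maximalIdeal R) →
    ringKrullDim (R ⧸ (K ⊔ ofList ys)) = n → HasDepth (K ⊔ ofList ys) n := by
  induction ys with
  | nil => intro K n h _ _ _; simpa using h
  | cons y ys ih =>
    intro K n h hK hm hdim
    have hy := hm y (by simp)
    have hKy := sup_le hK ((span_singleton_le_iff_mem _).2 hy)
    have hm' : ∀ z ∈ ys, z ∈ maximalIdeal R := fun z hz => hm z (by simp [hz])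
    rw [ofList_cons, ← sup_assoc] at hdim ⊢
    have hlt : ringKrullDim (R ⧸ (K ⊔ span {y})) < (n + (y :: ys).length : ℕ) := by
      refine (le_ringKrullDim_sup_ofList_add ys hKy hm').trans_lt ?_
      rw [hdim, List.length_cons]
      exact_mod_cast (by omega : n + ys.length < n + (ys.length + 1))
    exact ih (h.sup_span_singleton hy (h.regularMod hlt)) hKy hm' hdim

theorem isCohenMacaulayRing_quotient_map {A B : Type*} [CommRing A] [CommRing B]
    {ρ : R →+* A} {ρ' : R →+* B} (hρ : Function.Surjective ρ) (hρ' : Function.Surjective ρ')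
    {xs ys : List R} (hker : RingHom.ker ρ = ofList xs) (hker' : RingHom.ker ρ' = ofList ys)
    (hxs : ∀ x ∈ xs, x ∈ maximalIdeal R) (hys : ∀ y ∈ ys, y ∈ maximalIdeal R)
    {K : Ideal R} (hreg : RegularSeqMod K xs) {d d' : ℕ}
    (hd : ringKrullDim (A ⧸ K.map ρ) = d) (hd' : ringKrullDim (B ⧸ K.map ρ') = d')
    (hlen : xs.length + d = d' + ys.length) (hCM : IsCohenMacaulayRing (A ⧸ K.map ρ)) :
    IsCohenMacaulayRing (B ⧸ K.map ρ') := by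
  have := nontrivial_of_ringKrullDim_eq_natCast hd
  have := nontrivial_of_ringKrullDim_eq_natCast hd'
  have hs : Function.Surjective ((Ideal.Quotient.mk (K.map ρ)).comp ρ) :=
    Ideal.Quotient.mk_surjective.comp hρ
  have hs' : Function.Surjective ((Ideal.Quotient.mk (K.map ρ')).comp ρ') :=
    Ideal.Quotient.mk_surjective.comp hρ'
  have hk := ker_mk_comp_of_surjective hρ hker K
  have hk' := ker_mk_comp_of_surjective hρ' hker' K
  rw [isCohenMacaulayRing_iff_hasDepth_ker hs hd, hk] at hCM
  rw [isCohenMacaulayRing_iff_hasDepth_ker hs' hd', hk']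
  have hdepth := HasDepth.append hreg hxs hCM
  rw [hlen] at hdepth
  refine hdepth.sup_ofList ys ?_ hys ?_
  · refine le_maximalIdeal fun htop => ?_
    refine RingHom.ker_ne_top ((Ideal.Quotient.mk (K.map ρ)).comp ρ) ?_
    rw [hk, htop, top_sup_eq]
  · rw [← hd', ← hk']
    exact ringKrullDim_eq_of_ringEquiv (RingHom.quotientKerEquivOfSurjective hs')

end CohenMacaulayIdeals

section ConvergentPowerSeries

open scoped ENNReal

variable {σ : Type*} [Fintype σ]

/-- An injective multiplicative encoding of monomials by natural numbers: the variables
are sent to distinct primes. -/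
noncomputable def monomialCode (α : σ →₀ ℕ) : ℕ :=
  ∏ j, Nat.nth Nat.Prime (Fintype.equivFin σ j) ^ α j

theorem monomialCode_add (α β : σ →₀ ℕ) :
    monomialCode (α + β) = monomialCode α * monomialCode β := by
  simp [monomialCode, pow_add, Finset.prod_mul_distrib]

theorem monomialCode_pos (α : σ →₀ ℕ) : 0 < monomialCode α :=
  Finset.prod_pos fun _ _ => pow_pos (Nat.prime_nth_prime _).pos _

theorem factorization_monomialCode (α : σ →₀ ℕ) (i : σ) :
    (monomialCode α).factorization (Nat.nth Nat.Prime (Fintype.equivFin σ i)) = α i := by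
  classical
  rw [monomialCode, Nat.factorization_prod fun j _ =>
    pow_ne_zero _ (Nat.prime_nth_prime _).ne_zero, Finsupp.finsetSum_apply,
    Finset.sum_eq_single i]
  · simp
  · intro j _ hj
    have : Nat.nth Nat.Prime (Fintype.equivFin σ j) ≠ Nat.nth Nat.Prime (Fintype.equivFin σ i) :=
      fun h => hj ((Fintype.equivFin σ).injective
        (Fin.ext (Nat.nth_injective Nat.infinite_setOfPred_prime h)))
    simp [this]
  · simp

theorem monomialCode_injective : Function.Injective (monomialCode (σ := σ)) := fun α β h =>
  Finsupp.ext fun i => by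
    rw [← factorization_monomialCode α i, ← factorization_monomialCode β i, h]

/-- The value of a monomial at the polyradius with entries `p_j⁻ˢ`. -/
noncomputable def monomialWeight (s : ℕ) (α : σ →₀ ℕ) : ℝ≥0∞ := (monomialCode α : ℝ≥0∞)⁻¹ ^ s

theorem monomialWeight_add (s : ℕ) (α β : σ →₀ ℕ) :
    monomialWeight s (α + β) = monomialWeight s α * monomialWeight s β := by
  simp only [monomialWeight, monomialCode_add, Nat.cast_mul]
  rw [ENNReal.mul_inv (Or.inr (ENNReal.natCast_ne_top _)) (Or.inl (ENNReal.natCast_ne_top _)),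
    mul_pow]

theorem monomialWeight_ne_zero (s : ℕ) (α : σ →₀ ℕ) : monomialWeight s α ≠ 0 :=
  pow_ne_zero _ (ENNReal.inv_ne_zero.2 (ENNReal.natCast_ne_top _))

theorem monomialWeight_ne_top (s : ℕ) (α : σ →₀ ℕ) : monomialWeight s α ≠ ⊤ :=
  ENNReal.pow_ne_top (ENNReal.inv_ne_top.2 (Nat.cast_ne_zero.2 (monomialCode_pos α).ne'))

theorem inv_monomialCode_le_one (α : σ →₀ ℕ) : (monomialCode α : ℝ≥0∞)⁻¹ ≤ 1 :=
  ENNReal.inv_le_one.2 (Nat.one_le_cast.2 (monomialCode_pos α))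

theorem monomialWeight_antitone {s t : ℕ} (h : s ≤ t) (α : σ →₀ ℕ) :
    monomialWeight t α ≤ monomialWeight s α :=
  pow_le_pow_right_of_le_one' (inv_monomialCode_le_one α) h

/-- The weighted `ℓ¹` norm of a power series. -/
noncomputable def weightedNorm (s : ℕ) (f : MvPowerSeries σ ℂ) : ℝ≥0∞ :=
  ∑' α, ‖f.coeff α‖ₑ * monomialWeight s α

theorem weightedNorm_antitone {s t : ℕ} (h : s ≤ t) (f : MvPowerSeries σ ℂ) :
    weightedNorm t f ≤ weightedNorm s f :=
  ENNReal.tsum_le_tsum fun α => by gcongr; exact monomialWeight_antitone h α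

theorem weightedNorm_zero (s : ℕ) : weightedNorm s (0 : MvPowerSeries σ ℂ) = 0 := by
  simp [weightedNorm]

theorem weightedNorm_neg (s : ℕ) (f : MvPowerSeries σ ℂ) :
    weightedNorm s (-f) = weightedNorm s f := by
  simp [weightedNorm]

theorem weightedNorm_add_le (s : ℕ) (f g : MvPowerSeries σ ℂ) :
    weightedNorm s (f + g) ≤ weightedNorm s f + weightedNorm s g := by
  rw [weightedNorm, weightedNorm, weightedNorm, ← ENNReal.tsum_add]
  refine ENNReal.tsum_le_tsum fun α => ?_
  rw [← add_mul, map_add]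
  gcongr
  exact enorm_add_le _ _

theorem weightedNorm_sum_le {ι : Type*} (s : ℕ) (F : Finset ι) (f : ι → MvPowerSeries σ ℂ) :
    weightedNorm s (∑ i ∈ F, f i) ≤ ∑ i ∈ F, weightedNorm s (f i) := by
  classical
  induction F using Finset.induction_on with
  | empty => simp [weightedNorm_zero]
  | insert a F ha ih =>
    rw [Finset.sum_insert ha, Finset.sum_insert ha]
    exact (weightedNorm_add_le _ _ _).trans (by gcongr)

theorem weightedNorm_mul_le (s : ℕ) (f g : MvPowerSeries σ ℂ) :
    weightedNorm s (f * g) ≤ weightedNorm s f * weightedNorm s g := by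
  classical
  calc weightedNorm s (f * g)
      ≤ ∑' γ : σ →₀ ℕ, ∑' p : (Finset.HasAntidiagonal.antidiagonal γ : Finset _),
        (‖f.coeff p.1.1‖ₑ * monomialWeight s p.1.1)
          * (‖g.coeff p.1.2‖ₑ * monomialWeight s p.1.2) := by
        refine ENNReal.tsum_le_tsum fun γ => ?_
        rw [MvPowerSeries.coeff_mul, Finset.tsum_subtype _ fun p : (σ →₀ ℕ) × (σ →₀ ℕ) =>
          (‖f.coeff p.1‖ₑ * monomialWeight s p.1) * (‖g.coeff p.2‖ₑ * monomialWeight s p.2)]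
        refine (mul_le_mul_left (enorm_sum_le _ _) _).trans (le_of_eq ?_)
        rw [Finset.sum_mul]
        refine Finset.sum_congr rfl fun p hp => ?_
        rw [← Finset.HasAntidiagonal.mem_antidiagonal.1 hp, monomialWeight_add, enorm_mul]
        ring
    _ = ∑' p : (σ →₀ ℕ) × (σ →₀ ℕ),
        (‖f.coeff p.1‖ₑ * monomialWeight s p.1) * (‖g.coeff p.2‖ₑ * monomialWeight s p.2) := by
        rw [← ENNReal.tsum_sigma (fun (γ : σ →₀ ℕ)
            (p : (Finset.HasAntidiagonal.antidiagonal γ : Finset _)) =>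
            (‖f.coeff p.1.1‖ₑ * monomialWeight s p.1.1)
              * (‖g.coeff p.1.2‖ₑ * monomialWeight s p.1.2))]
        exact (Finset.HasAntidiagonal.sigmaAntidiagonalEquivProd (A := σ →₀ ℕ)).tsum_eq
          (fun p : (σ →₀ ℕ) × (σ →₀ ℕ) =>
        (‖f.coeff p.1‖ₑ * monomialWeight s p.1) * (‖g.coeff p.2‖ₑ * monomialWeight s p.2))
    _ = weightedNorm s f * weightedNorm s g := by
        rw [ENNReal.tsum_prod (f := fun α β : σ →₀ ℕ =>
          (‖f.coeff α‖ₑ * monomialWeight s α) * (‖g.coeff β‖ₑ * monomialWeight s β)),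
          weightedNorm, weightedNorm, ← ENNReal.tsum_mul_right]
        simp_rw [ENNReal.tsum_mul_left]

theorem weightedNorm_monomial (s : ℕ) (α : σ →₀ ℕ) (c : ℂ) :
    weightedNorm s (MvPowerSeries.monomial α c) = ‖c‖ₑ * monomialWeight s α := by
  classical
  rw [weightedNorm, tsum_eq_single α]
  · simp
  · intro β hβ
    simp [MvPowerSeries.coeff_monomial_ne hβ]

theorem enorm_coeff_mul_le_weightedNorm (s : ℕ) (f : MvPowerSeries σ ℂ) (α : σ →₀ ℕ) :
    ‖f.coeff α‖ₑ * monomialWeight s α ≤ weightedNorm s f :=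
  ENNReal.le_tsum α

/-- The ring of power series converging on some polydisc around the origin. -/
noncomputable def convergentPowerSeries (σ : Type*) [Fintype σ] :
    Subring (MvPowerSeries σ ℂ) where
  carrier := {f | ∃ s, weightedNorm s f ≠ ⊤}
  mul_mem' := by
    rintro f g ⟨s, hs⟩ ⟨t, ht⟩
    refine ⟨max s t, ((weightedNorm_mul_le _ f g).trans_lt (ENNReal.mul_lt_top ?_ ?_)).ne⟩
    · exact (weightedNorm_antitone (le_max_left s t) f).trans_lt hs.lt_top
    · exact (weightedNorm_antitone (le_max_right s t) g).trans_lt ht.lt_top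
  one_mem' := ⟨0, by
    rw [← MvPowerSeries.monomial_zero_one, weightedNorm_monomial]
    simp [monomialWeight]⟩
  add_mem' := by
    rintro f g ⟨s, hs⟩ ⟨t, ht⟩
    refine ⟨max s t, ((weightedNorm_add_le _ f g).trans_lt (ENNReal.add_lt_top.2 ⟨?_, ?_⟩)).ne⟩
    · exact (weightedNorm_antitone (le_max_left s t) f).trans_lt hs.lt_top
    · exact (weightedNorm_antitone (le_max_right s t) g).trans_lt ht.lt_top
  zero_mem' := ⟨0, by simp [weightedNorm_zero]⟩
  neg_mem' := by rintro f ⟨s, hs⟩; exact ⟨s, by rwa [weightedNorm_neg]⟩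

theorem monomial_mem_convergentPowerSeries (α : σ →₀ ℕ) (c : ℂ) :
    MvPowerSeries.monomial α c ∈ convergentPowerSeries σ :=
  ⟨0, by rw [weightedNorm_monomial]
         exact ENNReal.mul_ne_top enorm_ne_top (monomialWeight_ne_top _ _)⟩

section Division

/-- The part of a power series supported on `{α ∈ Δ | sel α = a}`, divided by the monomial of
exponent `a`. -/
noncomputable def partialQuotient {σ : Type*} (Δ : Set (σ →₀ ℕ)) (sel : (σ →₀ ℕ) → (σ →₀ ℕ))
    (a : σ →₀ ℕ) (h : MvPowerSeries σ ℂ) : MvPowerSeries σ ℂ :=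
  open Classical in fun β => if β + a ∈ Δ ∧ sel (β + a) = a then h.coeff (β + a) else 0

theorem coeff_partialQuotient {σ : Type*} (Δ : Set (σ →₀ ℕ)) (sel : (σ →₀ ℕ) → (σ →₀ ℕ))
    (a β : σ →₀ ℕ) (h : MvPowerSeries σ ℂ) [Decidable (β + a ∈ Δ ∧ sel (β + a) = a)] :
    (partialQuotient Δ sel a h).coeff β
      = if β + a ∈ Δ ∧ sel (β + a) = a then h.coeff (β + a) else 0 := by
  rw [MvPowerSeries.coeff_apply, partialQuotient]
  congr

theorem continuous_partialQuotient {σ : Type*} (Δ : Set (σ →₀ ℕ))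
    (sel : (σ →₀ ℕ) → (σ →₀ ℕ)) (a : σ →₀ ℕ) :
    open scoped MvPowerSeries.WithPiTopology in
    Continuous (partialQuotient Δ sel a) := by
  classical
  open scoped MvPowerSeries.WithPiTopology in
  refine continuous_pi fun β => ?_
  unfold partialQuotient
  split_ifs
  · exact MvPowerSeries.WithPiTopology.continuous_coeff ℂ _
  · exact continuous_const

variable (Δ : Set (σ →₀ ℕ)) (sel : (σ →₀ ℕ) → (σ →₀ ℕ))

theorem sum_weightedNorm_partialQuotient_le (s : ℕ) (F : Finset (σ →₀ ℕ))
    (h : MvPowerSeries σ ℂ) :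
    ∑ a ∈ F, weightedNorm s (partialQuotient Δ sel a h) * monomialWeight s a
      ≤ weightedNorm s h := by
  classical
  let ψ : (σ →₀ ℕ) → (σ →₀ ℕ) → ℝ≥0∞ := fun a α =>
    if sel α = a then ‖h.coeff α‖ₑ * monomialWeight s α else 0
  calc ∑ a ∈ F, weightedNorm s (partialQuotient Δ sel a h) * monomialWeight s a
      ≤ ∑ a ∈ F, ∑' α, ψ a α := by
        refine Finset.sum_le_sum fun a _ => ?_
        rw [weightedNorm, ← ENNReal.tsum_mul_right]
        refine le_trans (ENNReal.tsum_le_tsum fun β => ?_)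
          (ENNReal.tsum_comp_le_tsum_of_injective (add_left_injective a) (ψ a))
        rw [coeff_partialQuotient, mul_assoc, ← monomialWeight_add]
        by_cases hβ : sel (β + a) = a
        · simp only [ψ, hβ, and_true, if_true]
          split_ifs <;> simp
        · simp [ψ, hβ]
    _ = ∑' α, ∑ a ∈ F, ψ a α := (Summable.tsum_finsetSum fun _ _ => ENNReal.summable).symm
    _ ≤ weightedNorm s h := by
        refine ENNReal.tsum_le_tsum fun α => ?_
        simp only [ψ, Finset.sum_ite_eq]
        split_ifs <;> simp

theorem exists_add_eq_of_weightedNorm_le (s : ℕ) (D : MvPowerSeries σ ℂ → MvPowerSeries σ ℂ)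
    (hD : open scoped MvPowerSeries.WithPiTopology in Continuous D)
    (hadd : ∀ f g, D (f + g) = D f + D g)
    (hle : ∀ f, weightedNorm s (D f) ≤ 2⁻¹ * weightedNorm s f)
    (h : MvPowerSeries σ ℂ) (hh : weightedNorm s h ≠ ⊤) :
    ∃ g, weightedNorm s g ≠ ⊤ ∧ h = g + D g := by
  open scoped MvPowerSeries.WithPiTopology in
  let E : MvPowerSeries σ ℂ →+ MvPowerSeries σ ℂ :=
    { toFun := fun f => - D f
      map_zero' := by
        have := hadd 0 0
        rw [add_zero] at this
        simpa using this
      map_add' := fun f g => by rw [hadd, neg_add] }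
  have hEc : Continuous E := hD.neg
  let H : ℕ → MvPowerSeries σ ℂ := fun k => E^[k] h
  have hH : ∀ k, weightedNorm s (H k) ≤ 2⁻¹ ^ k * weightedNorm s h := by
    intro k
    induction k with
    | zero => simp [H]
    | succ k ih =>
      have : H (k + 1) = - D (H k) := Function.iterate_succ_apply' _ _ _
      rw [this, weightedNorm_neg, pow_succ', mul_assoc]
      exact (hle _).trans (by gcongr)
  have hgeom : ∑' k, 2⁻¹ ^ k * weightedNorm s h ≠ ⊤ := by
    rw [ENNReal.tsum_mul_right, ENNReal.tsum_geometric]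
    exact ENNReal.mul_ne_top (by simp) hh
  have hcoeff : ∀ α, ∑' k, ‖(H k).coeff α‖ₑ ≠ ⊤ := by
    intro α hα
    refine hgeom (top_le_iff.1 ?_)
    calc ⊤ = (∑' k, ‖(H k).coeff α‖ₑ) * monomialWeight s α := by
          rw [hα, ENNReal.top_mul (monomialWeight_ne_zero s α)]
      _ ≤ _ := by
          rw [← ENNReal.tsum_mul_right]
          exact ENNReal.tsum_le_tsum fun k =>
            (enorm_coeff_mul_le_weightedNorm s _ α).trans (hH k)
  have hsum : ∀ α, Summable fun k => (H k).coeff α := fun α => by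
    refine Summable.of_enorm (hcoeff α)
  have hS : Summable H := MvPowerSeries.WithPiTopology.summable_iff_summable_coeff.2 hsum
  refine ⟨∑' k, H k, ne_top_of_le_ne_top hgeom ?_, ?_⟩
  · refine le_trans ?_ (ENNReal.tsum_le_tsum hH)
    simp only [weightedNorm]
    rw [ENNReal.tsum_comm]
    refine ENNReal.tsum_le_tsum fun α => ?_
    rw [ENNReal.tsum_mul_right]
    gcongr
    have : (∑' k, H k).coeff α = ∑' k, (H k).coeff α :=
      hS.map_tsum (MvPowerSeries.coeff α).toAddMonoidHom
        (MvPowerSeries.WithPiTopology.continuous_coeff ℂ α)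
    rw [this]
    exact enorm_tsum_le_tsum_enorm
  · have h1 : E (∑' k, H k) = ∑' k, H (k + 1) := by
      rw [hS.map_tsum E hEc]
      exact tsum_congr fun k => (Function.iterate_succ_apply' E k h).symm
    have h2 := hS.tsum_eq_zero_add
    rw [← h1] at h2
    have h3 : E (∑' k, H k) = - D (∑' k, H k) := rfl
    rw [h3, ← sub_eq_add_neg, eq_sub_iff_add_eq] at h2
    exact h2.symm

theorem partialQuotient_add {σ : Type*} (Δ : Set (σ →₀ ℕ)) (sel : (σ →₀ ℕ) → (σ →₀ ℕ))
    (a : σ →₀ ℕ) (f g : MvPowerSeries σ ℂ) :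
    partialQuotient Δ sel a (f + g) = partialQuotient Δ sel a f + partialQuotient Δ sel a g := by
  classical
  ext β
  simp only [coeff_partialQuotient, map_add]
  split_ifs <;> simp

theorem exists_eq_remainder_add_sum (s : ℕ) (F : Finset (σ →₀ ℕ)) (Δ : Set (σ →₀ ℕ))
    (sel : (σ →₀ ℕ) → (σ →₀ ℕ)) (hsel : ∀ α ∈ Δ, sel α ∈ F ∧ sel α ≤ α)
    (f : (σ →₀ ℕ) → MvPowerSeries σ ℂ)
    (hf : ∀ a ∈ F, weightedNorm s (f a - MvPowerSeries.monomial a 1) ≤ 2⁻¹ * monomialWeight s a)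
    (h : MvPowerSeries σ ℂ) (hh : weightedNorm s h ≠ ⊤) :
    ∃ (q : (σ →₀ ℕ) → MvPowerSeries σ ℂ) (r : MvPowerSeries σ ℂ),
      (∀ a ∈ F, weightedNorm s (q a) ≠ ⊤) ∧ weightedNorm s r ≠ ⊤ ∧ (∀ α ∈ Δ, r.coeff α = 0) ∧
      h = r + ∑ a ∈ F, q a * f a := by
  classical
  obtain ⟨g, hg, hgh⟩ := exists_add_eq_of_weightedNorm_le s
    (fun g => ∑ a ∈ F, partialQuotient Δ sel a g * (f a - MvPowerSeries.monomial a 1))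
    (by
      open scoped MvPowerSeries.WithPiTopology in
      exact continuous_finsetSum _ fun a _ =>
        (continuous_partialQuotient Δ sel a).mul continuous_const)
    (fun f g => by simp only [partialQuotient_add, add_mul, Finset.sum_add_distrib])
    (fun g => by
      refine (weightedNorm_sum_le _ _ _).trans ?_
      refine le_trans ?_ (mul_le_mul_right (sum_weightedNorm_partialQuotient_le Δ sel s F g) _)
      rw [Finset.mul_sum]
      refine Finset.sum_le_sum fun a ha => (weightedNorm_mul_le _ _ _).trans ?_
      rw [mul_left_comm]
      gcongr
      exact hf a ha) h hh
  let r : MvPowerSeries σ ℂ := fun α => if α ∈ Δ then 0 else g.coeff α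
  have hr : ∀ α, r.coeff α = if α ∈ Δ then 0 else g.coeff α := fun _ => rfl
  have hdec : g = r + ∑ a ∈ F, partialQuotient Δ sel a g * MvPowerSeries.monomial a 1 := by
    ext α
    rw [map_add, map_sum, hr]
    simp only [MvPowerSeries.coeff_mul_monomial, coeff_partialQuotient, mul_one]
    by_cases hα : α ∈ Δ
    · rw [if_pos hα, zero_add, Finset.sum_eq_single (sel α)]
      · simp [(hsel α hα).2, tsub_add_cancel_of_le, hα]
      · intro b _ hb
        split_ifs with h1 h2
        · rw [tsub_add_cancel_of_le h1] at h2
          exact absurd h2.2.symm hb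
        · rfl
        · rfl
      · exact fun hn => absurd (hsel α hα).1 hn
    · rw [if_neg hα, Finset.sum_eq_zero, add_zero]
      intro b _
      split_ifs with h1 h2
      · rw [tsub_add_cancel_of_le h1] at h2
        exact absurd h2.1 hα
      · rfl
      · rfl
  refine ⟨fun a => partialQuotient Δ sel a g, r, fun a ha htop => ?_, ?_, ?_, ?_⟩
  · refine hg (top_le_iff.1 (le_trans ?_ (sum_weightedNorm_partialQuotient_le Δ sel s F g)))
    refine le_trans (le_of_eq ?_) (Finset.single_le_sum (f := fun a =>
      weightedNorm s (partialQuotient Δ sel a g) * monomialWeight s a) (fun _ _ => zero_le) ha)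
    simp only [htop, ENNReal.top_mul (monomialWeight_ne_zero s a)]
  · refine ne_top_of_le_ne_top hg (ENNReal.tsum_le_tsum fun α => ?_)
    rw [hr]
    split_ifs <;> simp
  · intro α hα
    rw [hr, if_pos hα]
  · simp only [mul_sub, Finset.sum_sub_distrib] at hgh
    rw [hgh]
    nth_rw 1 [hdec]
    abel

/-- `a` is the exponent of the leading monomial of `f`, whose coefficient is `1`. -/
def IsMonicWithLeading (f : MvPowerSeries σ ℂ) (a : σ →₀ ℕ) : Prop :=
  f.coeff a = 1 ∧ ∀ β, β ≠ a → f.coeff β ≠ 0 → monomialCode a < monomialCode β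

theorem IsMonicWithLeading.eventually_weightedNorm_le {f : MvPowerSeries σ ℂ} {a : σ →₀ ℕ}
    (hf : IsMonicWithLeading f a) (hc : f ∈ convergentPowerSeries σ) :
    ∀ᶠ s in atTop,
      weightedNorm s (f - MvPowerSeries.monomial a 1) ≤ 2⁻¹ * monomialWeight s a := by
  classical
  obtain ⟨s₀, hs₀⟩ := sub_mem hc (monomial_mem_convergentPowerSeries a 1)
  set u := f - MvPowerSeries.monomial a 1 with hu
  let θ : ℝ≥0∞ := monomialCode a * ((monomialCode a + 1 : ℕ) : ℝ≥0∞)⁻¹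
  have ha0 : (monomialCode a : ℝ≥0∞) ≠ 0 := Nat.cast_ne_zero.2 (monomialCode_pos a).ne'
  have hθ : θ < 1 := by
    refine (ENNReal.div_lt_iff (Or.inl (by simp)) (Or.inl (ENNReal.natCast_ne_top _))).2 ?_
    rw [one_mul]
    exact_mod_cast Nat.lt_succ_self _
  have hlim : Tendsto (fun k : ℕ => weightedNorm s₀ u * θ ^ k) atTop (𝓝 0) := by
    have := ENNReal.Tendsto.const_mul (ENNReal.tendsto_pow_atTop_nhds_zero_of_lt_one hθ)
      (Or.inr hs₀)
    simpa using this
  have hpos : 0 < 2⁻¹ * monomialWeight s₀ a :=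
    ENNReal.mul_pos (by simp) (monomialWeight_ne_zero _ _)
  have hev := hlim.eventually (gt_mem_nhds hpos)
  rw [← Filter.map_add_atTop_eq_nat s₀, Filter.eventually_map]
  filter_upwards [hev] with k hk
  have hcode : ∀ β, u.coeff β ≠ 0 → monomialCode a + 1 ≤ monomialCode β := by
    intro β hβ
    by_cases hβa : β = a
    · subst hβa
      simp [hu, hf.1] at hβ
    · refine hf.2 β hβa ?_
      rwa [hu, map_sub, MvPowerSeries.coeff_monomial_ne hβa, sub_zero] at hβ
  have hw : ∀ α : σ →₀ ℕ,
      monomialWeight (k + s₀) α = monomialWeight s₀ α * (monomialCode α : ℝ≥0∞)⁻¹ ^ k := by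
    intro α
    rw [monomialWeight, monomialWeight, pow_add, mul_comm]
  calc weightedNorm (k + s₀) u
      ≤ weightedNorm s₀ u * ((monomialCode a + 1 : ℕ) : ℝ≥0∞)⁻¹ ^ k := by
        rw [weightedNorm, weightedNorm, ← ENNReal.tsum_mul_right]
        refine ENNReal.tsum_le_tsum fun β => ?_
        by_cases hβ : u.coeff β = 0
        · simp [hβ]
        · rw [hw, ← mul_assoc]
          gcongr
          exact hcode β hβ
    _ = (weightedNorm s₀ u * θ ^ k) * (monomialCode a : ℝ≥0∞)⁻¹ ^ k := by
        rw [mul_assoc, ← mul_pow, mul_right_comm,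
          ENNReal.mul_inv_cancel ha0 (ENNReal.natCast_ne_top _), one_mul]
    _ ≤ 2⁻¹ * monomialWeight s₀ a * (monomialCode a : ℝ≥0∞)⁻¹ ^ k := by gcongr
    _ = 2⁻¹ * monomialWeight (k + s₀) a := by rw [hw, mul_assoc]

theorem exists_isMonicWithLeading {f : MvPowerSeries σ ℂ} (hf : f ≠ 0) :
    ∃ (a : σ →₀ ℕ), f.coeff a ≠ 0 ∧
      IsMonicWithLeading (MvPowerSeries.monomial 0 (f.coeff a)⁻¹ * f) a := by
  classical
  obtain ⟨α₀, hα₀⟩ : ∃ α, f.coeff α ≠ 0 := by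
    by_contra! h
    exact hf (MvPowerSeries.ext h)
  have hne : {α | f.coeff α ≠ 0}.Nonempty := ⟨α₀, hα₀⟩
  let a := Function.argminOn monomialCode {α | f.coeff α ≠ 0} hne
  have ha : f.coeff a ≠ 0 := Function.argminOn_mem monomialCode {α | f.coeff α ≠ 0} hne
  have hmul : ∀ β, (MvPowerSeries.monomial 0 (f.coeff a)⁻¹ * f).coeff β
      = (f.coeff a)⁻¹ * f.coeff β := fun β => by
    simp
  refine ⟨a, ha, by rw [hmul, inv_mul_cancel₀ ha], fun β hβ hβ0 => ?_⟩
  rw [hmul] at hβ0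
  refine lt_of_le_of_ne (Function.argminOn_le monomialCode {α | f.coeff α ≠ 0}
    (show β ∈ {α | f.coeff α ≠ 0} from right_ne_zero_of_mul hβ0))
    fun h => hβ (monomialCode_injective h.symm)

theorem isNoetherianRing_convergentPowerSeries : IsNoetherianRing (convergentPowerSeries σ) := by
  classical
  refine (isNoetherianRing_iff_ideal_fg _).2 fun I => ?_
  let Δ : Set (σ →₀ ℕ) := {a | ∃ f ∈ I, IsMonicWithLeading (f : MvPowerSeries σ ℂ) a}
  have hfin : {a | Minimal (· ∈ Δ) a}.Finite :=
    WellQuasiOrderedLE.finite_of_isAntichain (setOfPred_minimal_antichain _)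
  let F := hfin.toFinset
  have hmin : ∀ α ∈ Δ, ∃ a, a ∈ F ∧ a ≤ α := fun α hα => by
    obtain ⟨a, hle, ha⟩ := exists_minimal_le_of_wellFoundedLT (· ∈ Δ) α hα
    exact ⟨a, hfin.mem_toFinset.2 ha, hle⟩
  have hFΔ : ∀ a ∈ F, a ∈ Δ := fun a ha => (hfin.mem_toFinset.1 ha).1
  choose! sel hsel using hmin
  choose! f hfI hfl using hFΔ
  refine ⟨F.image f, le_antisymm ?_ ?_⟩
  · rw [Ideal.span_le]
    intro x hx
    obtain ⟨a, ha, rfl⟩ := Finset.mem_image.1 hx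
    exact hfI a ha
  · intro h hhI
    obtain ⟨s₀, hs₀⟩ := h.2
    have hev : ∀ᶠ s in atTop, ∀ a ∈ F, weightedNorm s
        ((f a : MvPowerSeries σ ℂ) - MvPowerSeries.monomial a 1) ≤ 2⁻¹ * monomialWeight s a :=
      (Finset.eventually_all F).2 fun a ha => (hfl a ha).eventually_weightedNorm_le (f a).2
    obtain ⟨s, hs, hss₀⟩ := (hev.and (eventually_ge_atTop s₀)).exists
    obtain ⟨q, r, hq, hr, hrΔ, heq⟩ := exists_eq_remainder_add_sum s F Δ sel hsel
      (fun a => (f a : MvPowerSeries σ ℂ)) hs h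
      (ne_top_of_le_ne_top hs₀ (weightedNorm_antitone hss₀ _))
    let q' : (σ →₀ ℕ) → convergentPowerSeries σ := fun a =>
      if ha : a ∈ F then ⟨q a, s, hq a ha⟩ else 0
    let r' : convergentPowerSeries σ := ⟨r, s, hr⟩
    have heq' : h = r' + ∑ a ∈ F, q' a * f a := by
      refine Subtype.ext ?_
      rw [heq, Subring.coe_add, AddSubmonoidClass.coe_finsetSum]
      refine congrArg _ (Finset.sum_congr rfl fun a ha => ?_)
      simp [q', ha]
    have hsum : ∀ K : Ideal (convergentPowerSeries σ), (∀ a ∈ F, f a ∈ K) →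
        ∑ a ∈ F, q' a * f a ∈ K := fun K hK =>
      sum_mem fun a ha => K.mul_mem_left _ (hK a ha)
    have hrI : r' ∈ I := by
      rw [eq_sub_of_add_eq heq'.symm]
      exact sub_mem hhI (hsum I hfI)
    have hr0 : r = 0 := by
      by_contra hne
      obtain ⟨a, ha, hlead⟩ := exists_isMonicWithLeading hne
      let c : convergentPowerSeries σ :=
        ⟨MvPowerSeries.monomial 0 (r.coeff a)⁻¹, monomial_mem_convergentPowerSeries 0 _⟩
      have hc : ((c * r' : convergentPowerSeries σ) : MvPowerSeries σ ℂ)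
          = MvPowerSeries.monomial 0 (r.coeff a)⁻¹ * r := Subring.coe_mul _ _ _
      exact ha (hrΔ a ⟨c * r', I.mul_mem_left _ hrI, by rw [hc]; exact hlead⟩)
    have hr'0 : r' = 0 := Subtype.ext hr0
    rw [heq', hr'0, zero_add]
    exact hsum _ fun a ha => Ideal.subset_span (Finset.mem_coe.2 (Finset.mem_image_of_mem f ha))


end Division

section Evaluation

theorem two_pow_degree_le_monomialCode (α : σ →₀ ℕ) : 2 ^ α.degree ≤ monomialCode α := by
  rw [Finsupp.degree_eq_sum, ← Finset.prod_pow_eq_pow_sum]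
  exact Finset.prod_le_prod' fun j _ =>
    Nat.pow_le_pow_left (Nat.prime_nth_prime _).two_le _

theorem monomialCode_le_pow_degree (α : σ →₀ ℕ) :
    monomialCode α ≤ (∏ j : σ, Nat.nth Nat.Prime (Fintype.equivFin σ j)) ^ α.degree := by
  rw [Finsupp.degree_eq_sum, ← Finset.prod_pow_eq_pow_sum]
  exact Finset.prod_le_prod' fun j hj => Nat.pow_le_pow_left
    (Finset.single_le_prod' (f := fun j : σ => Nat.nth Nat.Prime (Fintype.equivFin σ j))
      (fun _ _ => (Nat.prime_nth_prime _).one_le) hj) _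

theorem mem_convergentPowerSeries_of_tsum_ne_top {f : MvPowerSeries σ ℂ} {ρ : ℝ≥0∞} (hρ : ρ ≠ 0)
    (hf : ∑' α, ‖f.coeff α‖ₑ * ρ ^ α.degree ≠ ⊤) : f ∈ convergentPowerSeries σ := by
  have hlim : Tendsto (fun s : ℕ => (2⁻¹ : ℝ≥0∞) ^ s) atTop (𝓝 0) :=
    ENNReal.tendsto_pow_atTop_nhds_zero_of_lt_one ENNReal.one_half_lt_one
  obtain ⟨s, hs⟩ := (hlim.eventually (gt_mem_nhds (pos_iff_ne_zero.2 hρ))).exists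
  refine ⟨s, ne_top_of_le_ne_top hf (ENNReal.tsum_le_tsum fun α => ?_)⟩
  refine mul_le_mul_right (le_trans ?_ (pow_le_pow_left' hs.le _)) _
  rw [monomialWeight, ← pow_mul, mul_comm, pow_mul, ENNReal.inv_pow (a := 2).symm]
  gcongr
  exact_mod_cast two_pow_degree_le_monomialCode α

theorem exists_summable_of_mem_convergentPowerSeries {f : MvPowerSeries σ ℂ}
    (hf : f ∈ convergentPowerSeries σ) :
    ∃ ρ : ℝ, 0 < ρ ∧ Summable fun α => ‖f.coeff α‖ * ρ ^ α.degree := by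
  obtain ⟨s, hs⟩ := hf
  set N := ∏ j : σ, Nat.nth Nat.Prime (Fintype.equivFin σ j) with hN
  have hN0 : 0 < N := Finset.prod_pos fun _ _ => (Nat.prime_nth_prime _).pos
  refine ⟨((N : ℝ)⁻¹) ^ s, by positivity, ?_⟩
  refine Summable.of_enorm (ne_top_of_le_ne_top hs (ENNReal.tsum_le_tsum fun α => ?_))
  rw [enorm_mul, enorm_norm, enorm_pow, enorm_pow]
  gcongr
  rw [monomialWeight, ← pow_mul, mul_comm, pow_mul]
  gcongr
  rw [enorm_inv (by positivity), ← ENNReal.inv_pow]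
  gcongr
  have : ‖(N : ℝ)‖ₑ = (N : ℝ≥0∞) := by simp
  rw [this]
  exact_mod_cast monomialCode_le_pow_degree α

/-- The value at `x` of the sum of a power series. -/
noncomputable def powerSeriesEval (f : MvPowerSeries σ ℂ) (x : σ → ℂ) : ℂ :=
  ∑' α, f.coeff α * ∏ j, x j ^ α j

theorem norm_prod_pow_le {ρ : ℝ} {x : σ → ℂ} (hx : ‖x‖ ≤ ρ) (α : σ →₀ ℕ) :
    ‖∏ j, x j ^ α j‖ ≤ ρ ^ α.degree := by
  rw [norm_prod, Finsupp.degree_eq_sum, ← Finset.prod_pow_eq_pow_sum]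
  refine Finset.prod_le_prod (fun _ _ => norm_nonneg _) fun j _ => ?_
  rw [norm_pow]
  gcongr
  exact (norm_le_pi_norm x j).trans hx

theorem eventually_summable_norm {f : MvPowerSeries σ ℂ} (hf : f ∈ convergentPowerSeries σ) :
    ∀ᶠ x in 𝓝 (0 : σ → ℂ), Summable fun α => ‖f.coeff α * ∏ j, x j ^ α j‖ := by
  obtain ⟨ρ, hρ, hs⟩ := exists_summable_of_mem_convergentPowerSeries hf
  filter_upwards [Metric.closedBall_mem_nhds (0 : σ → ℂ) hρ] with x hx
  refine hs.of_nonneg_of_le (fun _ => norm_nonneg _) fun α => ?_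
  rw [norm_mul]
  gcongr
  exact norm_prod_pow_le (mem_closedBall_zero_iff.1 hx) α

theorem exists_continuousMultilinearMap_monomial (α : σ →₀ ℕ) {k : ℕ} (hα : α.degree = k) :
    ∃ M : ContinuousMultilinearMap ℂ (fun _ : Fin k => σ → ℂ) ℂ, ‖M‖ ≤ 1 ∧
      ∀ x, M (fun _ => x) = ∏ j, x j ^ α j := by
  classical
  obtain ⟨L, hL⟩ := Quot.exists_rep (Finsupp.toMultiset α)
  replace hL : (L : Multiset σ) = Finsupp.toMultiset α := hL
  have hlen : L.length = k := by
    rw [← Multiset.coe_card, hL, Finsupp.card_toMultiset, ← hα]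
    rfl
  subst hlen
  refine ⟨(ContinuousMultilinearMap.mkPiAlgebra ℂ (Fin L.length) ℂ).compContinuousLinearMap
    fun l => ContinuousLinearMap.proj (R := ℂ) (φ := fun _ : σ => ℂ) (L.get l), ?_, fun x => ?_⟩
  · refine ContinuousMultilinearMap.opNorm_le_bound zero_le_one fun m => ?_
    rw [one_mul, ContinuousMultilinearMap.compContinuousLinearMap_apply,
      ContinuousMultilinearMap.mkPiAlgebra_apply, norm_prod]
    exact Finset.prod_le_prod (fun _ _ => norm_nonneg _) fun l _ => norm_le_pi_norm (m l) _
  · rw [ContinuousMultilinearMap.compContinuousLinearMap_apply,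
      ContinuousMultilinearMap.mkPiAlgebra_apply]
    simp only [ContinuousLinearMap.proj_apply, List.get_eq_getElem]
    rw [Fin.prod_univ_fun_getElem L x, ← Multiset.prod_coe, ← Multiset.map_coe, hL,
      Finsupp.toMultiset_map, Finsupp.prod_toMultiset, Finsupp.prod_mapDomain_index
        (fun _ => pow_zero _) (fun _ _ _ => pow_add _ _ _)]
    exact Finsupp.prod_fintype _ _ fun _ => pow_zero _

theorem analyticAt_powerSeriesEval {f : MvPowerSeries σ ℂ} (hf : f ∈ convergentPowerSeries σ) :
    AnalyticAt ℂ (powerSeriesEval f) 0 := by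
  classical
  obtain ⟨ρ, hρ, hs⟩ := exists_summable_of_mem_convergentPowerSeries hf
  let S : ℕ → Finset (σ →₀ ℕ) := fun k => Finset.finsuppAntidiag Finset.univ k
  have hS : ∀ k α, α ∈ S k ↔ α.degree = k := fun k α => by
    simp [S, Finset.mem_finsuppAntidiag, Finsupp.degree_eq_sum]
  have hS' : ∀ k, (S k : Set (σ →₀ ℕ)) = Finsupp.degree ⁻¹' {k} := fun k => by
    ext α
    simp [hS]
  choose! M hM1 hM using fun (k : ℕ) (α : σ →₀ ℕ) (h : α.degree = k) =>
    exists_continuousMultilinearMap_monomial α h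
  let p : FormalMultilinearSeries ℂ (σ → ℂ) ℂ := fun k => ∑ α ∈ S k, f.coeff α • M k α
  have hfib : ∀ (u : (σ →₀ ℕ) → ℝ), Summable u → Summable fun k => ∑ α ∈ S k, u α := by
    intro u hu
    have := (hu.hasSum.tsum_fiberwise (Finsupp.degree : (σ →₀ ℕ) → ℕ)).summable
    refine this.congr fun k => ?_
    rw [← hS' k]
    exact (Finset.tsum_subtype' (S k) u)
  have hrad : ENNReal.ofReal ρ ≤ p.radius := by
    refine p.le_radius_of_summable (r := ρ.toNNReal) ?_
    refine (hfib _ hs).of_nonneg_of_le (fun _ => by positivity) fun k => ?_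
    rw [Real.coe_toNNReal _ hρ.le]
    refine (mul_le_mul_of_nonneg_right (norm_sum_le _ _) (by positivity)).trans ?_
    rw [Finset.sum_mul]
    refine Finset.sum_le_sum fun α hα => ?_
    rw [(hS k α).1 hα, norm_smul]
    gcongr
    exact mul_le_of_le_one_right (norm_nonneg _) (hM1 k α ((hS k α).1 hα))
  have hpos : 0 < p.radius := lt_of_lt_of_le (ENNReal.ofReal_pos.2 hρ) hrad
  refine (p.hasFPowerSeriesOnBall hpos).analyticAt.congr ?_
  filter_upwards [eventually_summable_norm hf] with x hx
  have := (hx.of_norm.hasSum.tsum_fiberwise (Finsupp.degree : (σ →₀ ℕ) → ℕ)).tsum_eq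
  rw [powerSeriesEval, ← this, FormalMultilinearSeries.sum]
  refine tsum_congr fun k => ?_
  rw [← hS' k, Finset.tsum_subtype' (S k) fun α => f.coeff α * ∏ j, x j ^ α j,
    sum_apply]
  refine Finset.sum_congr rfl fun α hα => ?_
  rw [smul_apply, hM k α ((hS k α).1 hα), smul_eq_mul]

theorem powerSeriesEval_monomial (α : σ →₀ ℕ) (c : ℂ) (x : σ → ℂ) :
    powerSeriesEval (MvPowerSeries.monomial α c) x = c * ∏ j, x j ^ α j := by
  classical
  rw [powerSeriesEval, tsum_eq_single α]
  · simp
  · intro β hβ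
    simp [MvPowerSeries.coeff_monomial_ne hβ]

theorem powerSeriesEval_mul {f g : MvPowerSeries σ ℂ} {x : σ → ℂ}
    (hf : Summable fun α => ‖f.coeff α * ∏ j, x j ^ α j‖)
    (hg : Summable fun α => ‖g.coeff α * ∏ j, x j ^ α j‖) :
    powerSeriesEval (f * g) x = powerSeriesEval f x * powerSeriesEval g x := by
  classical
  let u : (σ →₀ ℕ) → ℂ := fun α => f.coeff α * ∏ j, x j ^ α j
  let v : (σ →₀ ℕ) → ℂ := fun α => g.coeff α * ∏ j, x j ^ α j
  have key : (∑' α, u α) * ∑' α, v α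
      = ∑' α, ∑ p ∈ Finset.HasAntidiagonal.antidiagonal α, u p.1 * v p.2 :=
    Summable.tsum_mul_tsum_eq_tsum_sum_antidiagonal (f := u) (g := v) hf.of_norm hg.of_norm
      (summable_mul_of_summable_norm (f := u) (g := v) hf hg)
  refine Eq.trans (tsum_congr fun α => ?_) key.symm
  rw [MvPowerSeries.coeff_mul, Finset.sum_mul]
  refine Finset.sum_congr rfl fun p hp => ?_
  rw [← Finset.HasAntidiagonal.mem_antidiagonal.1 hp]
  simp only [u, v, Finsupp.add_apply, pow_add, Finset.prod_mul_distrib]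
  ring

/-- The ring homomorphism sending a convergent power series to the germ of its sum. -/
noncomputable def powerSeriesGerm (σ : Type*) [Fintype σ] :
    convergentPowerSeries σ →+* analyticGerms (σ → ℂ) 0 where
  toFun f := ⟨(powerSeriesEval (f : MvPowerSeries σ ℂ) : Germ (𝓝 (0 : σ → ℂ)) ℂ),
    _, analyticAt_powerSeriesEval f.2, rfl⟩
  map_one' := Subtype.ext <| Germ.coe_eq.2 <| Eventually.of_forall fun x => by
    rw [Subring.coe_one, ← MvPowerSeries.monomial_zero_one, powerSeriesEval_monomial]
    simp
  map_zero' := Subtype.ext <| Germ.coe_eq.2 <| Eventually.of_forall fun x => by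
    simp [powerSeriesEval]
  map_add' f g := Subtype.ext <| Germ.coe_eq.2 <| by
    filter_upwards [eventually_summable_norm f.2, eventually_summable_norm g.2] with x hf hg
    simp only [powerSeriesEval, Subring.coe_add, map_add, add_mul]
    exact hf.of_norm.tsum_add hg.of_norm
  map_mul' f g := Subtype.ext <| Germ.coe_eq.2 <| by
    filter_upwards [eventually_summable_norm f.2, eventually_summable_norm g.2] with x hf hg
    exact powerSeriesEval_mul hf hg

end Evaluation

section Surjectivity

/-- The exponent of the monomial given by a word in the variables. -/
noncomputable def wordContent {σ : Type*} (w : Σ k : ℕ, Fin k → σ) : σ →₀ ℕ :=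
  ∑ l, Finsupp.single (w.2 l) 1

theorem degree_wordContent {σ : Type*} (w : Σ k : ℕ, Fin k → σ) :
    (wordContent w).degree = w.1 := by
  simp [wordContent, map_sum, Finsupp.degree_single]

theorem prod_pow_wordContent (w : Σ k : ℕ, Fin k → σ) (x : σ → ℂ) :
    ∏ j, x j ^ wordContent w j = ∏ l, x (w.2 l) := by
  classical
  simp only [wordContent, Finsupp.finsetSum_apply, ← Finset.prod_pow_eq_pow_sum]
  rw [Finset.prod_comm]
  refine Finset.prod_congr rfl fun l _ => ?_
  rw [Finset.prod_eq_single (w.2 l)]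
  · simp
  · intro j _ hj
    simp [Finsupp.single_eq_of_ne hj]
  · simp

theorem ContinuousMultilinearMap.apply_diagonal_eq_sum [DecidableEq σ] {k : ℕ}
    (M : ContinuousMultilinearMap ℂ (fun _ : Fin k => σ → ℂ) ℂ) (x : σ → ℂ) :
    M (fun _ => x) = ∑ w : Fin k → σ, M (fun l => Pi.single (w l) 1) * ∏ l, x (w l) := by
  have hx : x = ∑ j, x j • (Pi.single j 1 : σ → ℂ) := pi_eq_sum_univ' x
  conv_lhs => rw [hx]
  rw [M.map_sum]
  refine Finset.sum_congr rfl fun w _ => ?_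
  rw [M.map_smul_univ (fun l => x (w l)), smul_eq_mul, mul_comm]

theorem exists_powerSeriesEval_eventuallyEq {F : (σ → ℂ) → ℂ} (hF : AnalyticAt ℂ F 0) :
    ∃ f ∈ convergentPowerSeries σ, powerSeriesEval f =ᶠ[𝓝 0] F := by
  classical
  obtain ⟨p, R, hp⟩ := hF
  obtain ⟨r, hr0, hrR⟩ := ENNReal.lt_iff_exists_nnreal_btwn.1 hp.r_pos
  have hr0 : 0 < r := ENNReal.coe_pos.1 hr0
  let n := Fintype.card σ
  let ρ : NNReal := r / (n + 1)
  have hρ0 : 0 < ρ := by positivity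
  have hnρ : n * ρ ≤ r := by
    calc (n : NNReal) * ρ ≤ (n + 1) * ρ := by gcongr; simp
      _ = r := mul_div_cancel₀ _ (by positivity)
  have hρr : ρ ≤ r := div_le_self hr0.le (by simp)
  let c : (Σ k : ℕ, Fin k → σ) → ℂ := fun w => p w.1 fun l => Pi.single (w.2 l) 1
  have hc : ∀ w, ‖c w‖ₑ ≤ ‖p w.1‖ₑ := fun w => by
    rw [← ofReal_norm, ← ofReal_norm]
    refine ENNReal.ofReal_le_ofReal (((p w.1).le_opNorm _).trans ?_)
    refine mul_le_of_le_one_right (norm_nonneg _) (Finset.prod_le_one (fun _ _ => norm_nonneg _) ?_)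
    intro l _
    rw [Pi.norm_single, norm_one]
  have hp1 : ∑' k, ‖p k‖ₑ * (r : ℝ≥0∞) ^ k ≠ ⊤ := by
    have := tsum_enorm_ne_top_iff_summable_norm.2
      (p.summable_norm_mul_pow (hrR.trans_le hp.r_le)).norm
    simpa [enorm_mul, enorm_pow] using this
  have hcW : ∑' w, ‖c w‖ₑ * (ρ : ℝ≥0∞) ^ w.1 ≠ ⊤ := by
    refine ne_top_of_le_ne_top hp1 ?_
    rw [ENNReal.tsum_sigma']
    refine ENNReal.tsum_le_tsum fun k => ?_
    rw [tsum_fintype]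
    refine (Finset.sum_le_card_nsmul _ _ (‖p k‖ₑ * (ρ : ℝ≥0∞) ^ k) fun w _ => ?_).trans ?_
    · gcongr
      exact hc ⟨k, w⟩
    · rw [Finset.card_univ, Fintype.card_pi_const, nsmul_eq_mul, mul_left_comm]
      gcongr
      rw [Nat.cast_pow, ← mul_pow]
      gcongr
      exact_mod_cast hnρ
  have hcs : ∀ x : σ → ℂ, ‖x‖ ≤ ρ →
      Summable fun w : (Σ k : ℕ, Fin k → σ) => c w * ∏ l, x (w.2 l) := by
    intro x hx
    refine Summable.of_enorm (ne_top_of_le_ne_top hcW (ENNReal.tsum_le_tsum fun w => ?_))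
    rw [enorm_mul, ← prod_pow_wordContent]
    gcongr
    have := norm_prod_pow_le hx (wordContent w)
    rw [degree_wordContent] at this
    exact_mod_cast this
  let f : MvPowerSeries σ ℂ := fun α => ∑' w : wordContent ⁻¹' {α}, c w
  have hf : ∀ α, f.coeff α = ∑' w : wordContent ⁻¹' {α}, c w := fun _ => rfl
  refine ⟨f, mem_convergentPowerSeries_of_tsum_ne_top (ρ := ρ)
    (ENNReal.coe_ne_zero.2 hρ0.ne') ?_, ?_⟩
  · refine ne_top_of_le_ne_top hcW ?_
    rw [← ENNReal.tsum_fiberwise _ wordContent]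
    refine ENNReal.tsum_le_tsum fun α => ?_
    rw [hf]
    refine (mul_le_mul_left enorm_tsum_le_tsum_enorm _).trans (le_of_eq ?_)
    rw [← ENNReal.tsum_mul_right]
    refine tsum_congr fun w => ?_
    rw [← degree_wordContent w.1, show wordContent w.1 = α from w.2]
  · have hball : Metric.eball (0 : σ → ℂ) R ∈ 𝓝 0 := Metric.eball_mem_nhds _ hp.r_pos
    filter_upwards [Metric.closedBall_mem_nhds (0 : σ → ℂ) (NNReal.coe_pos.2 hρ0), hball]
      with x hx hxR
    have hs := hcs x (mem_closedBall_zero_iff.1 hx)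
    have h1 := (hs.hasSum.tsum_fiberwise wordContent).tsum_eq
    have h2 := hp.hasSum hxR
    rw [zero_add] at h2
    rw [← h2.tsum_eq, powerSeriesEval]
    calc ∑' α, f.coeff α * ∏ j, x j ^ α j
        = ∑' α, ∑' w : wordContent ⁻¹' {α}, c w * ∏ l, x (w.1.2 l) := by
          refine tsum_congr fun α => ?_
          rw [hf, ← tsum_mul_right]
          refine tsum_congr fun w => ?_
          rw [← prod_pow_wordContent, show wordContent w.1 = α from w.2]
      _ = ∑' w, c w * ∏ l, x (w.2 l) := h1
      _ = ∑' k, p k fun _ => x := by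
          rw [hs.tsum_sigma]
          refine tsum_congr fun k => ?_
          rw [tsum_fintype, ContinuousMultilinearMap.apply_diagonal_eq_sum (p k) x]

theorem powerSeriesGerm_surjective : Function.Surjective (powerSeriesGerm σ) := by
  rintro ⟨_, F, hF, rfl⟩
  obtain ⟨f, hf, h⟩ := exists_powerSeriesEval_eventuallyEq hF
  exact ⟨⟨f, hf⟩, Subtype.ext (Germ.coe_eq.2 h)⟩

theorem isNoetherianRing_analyticGerms : IsNoetherianRing (analyticGerms (σ → ℂ) 0) :=
  have := isNoetherianRing_convergentPowerSeries (σ := σ)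
  isNoetherianRing_of_surjective _ _ _ powerSeriesGerm_surjective

theorem exists_eq_update_add_mul [DecidableEq σ] (j : σ) {F : (σ → ℂ) → ℂ}
    (hF : AnalyticAt ℂ F 0) :
    ∃ G, AnalyticAt ℂ G 0 ∧ ∀ᶠ x in 𝓝 0, F x = F (Function.update x j 0) + x j * G x := by
  classical
  obtain ⟨f, ⟨s, hs⟩, hfF⟩ := exists_powerSeriesEval_eventuallyEq hF
  let e : σ →₀ ℕ := Finsupp.single j 1
  let g := partialQuotient Set.univ (fun _ => e) e f
  have hg : ∀ β, g.coeff β = f.coeff (β + e) := fun β => by simp [g, coeff_partialQuotient]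
  have hgc : g ∈ convergentPowerSeries σ := by
    refine ⟨s, fun htop => hs (top_le_iff.1 ?_)⟩
    have := sum_weightedNorm_partialQuotient_le Set.univ (fun _ => e) s {e} f
    rwa [Finset.sum_singleton, show weightedNorm s (partialQuotient _ _ e f) = ⊤ from htop,
      ENNReal.top_mul (monomialWeight_ne_zero _ _)] at this
  let X : convergentPowerSeries σ :=
    ⟨MvPowerSeries.monomial e 1, monomial_mem_convergentPowerSeries e 1⟩
  let f' : convergentPowerSeries σ := ⟨f, s, hs⟩
  let g' : convergentPowerSeries σ := ⟨g, hgc⟩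
  have hsub : ∀ x, powerSeriesEval (f - MvPowerSeries.monomial e 1 * g) x
      = powerSeriesEval f (Function.update x j 0) := by
    intro x
    refine tsum_congr fun α => ?_
    rw [map_sub, MvPowerSeries.coeff_monomial_mul, one_mul, hg]
    by_cases hα : α j = 0
    · rw [if_neg, sub_zero]
      · congr 1
        refine Finset.prod_congr rfl fun i _ => ?_
        by_cases hi : i = j
        · subst hi; simp [hα]
        · rw [Function.update_of_ne hi]
      · intro h
        have := h j
        simp [e, hα] at this
    · have hle : e ≤ α := by
        rw [Finsupp.single_le_iff]
        exact Nat.one_le_iff_ne_zero.2 hα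
      rw [if_pos hle, tsub_add_cancel_of_le hle, sub_self, zero_mul,
        Finset.prod_eq_zero (Finset.mem_univ j), mul_zero]
      simp [hα]
  have hev := Germ.coe_eq.1 (congrArg Subtype.val
    (show powerSeriesGerm σ f' = powerSeriesGerm σ (f' - X * g') + powerSeriesGerm σ X *
      powerSeriesGerm σ g' by rw [← map_mul, ← map_add, sub_add_cancel]))
  have hupd : Tendsto (fun x : σ → ℂ => Function.update x j 0) (𝓝 0) (𝓝 0) := by
    have : Continuous fun x : σ → ℂ => Function.update x j 0 :=
      continuous_id.update j continuous_const
    simpa using this.tendsto 0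
  refine ⟨_, analyticAt_powerSeriesEval hgc, ?_⟩
  filter_upwards [hev, hfF, hupd.eventually hfF] with x h1 h2 h3
  rw [← h2, ← h3, ← hsub]
  refine h1.trans (congrArg₂ _ rfl (congrArg₂ _ ?_ rfl))
  refine (powerSeriesEval_monomial e 1 x).trans ?_
  rw [one_mul, Finset.prod_eq_single j]
  · simp [e]
  · intro i _ hi
    simp [e, Finsupp.single_eq_of_ne hi]
  · simp

end Surjectivity

end ConvergentPowerSeries

theorem regularMod_span_of_retraction {R : Type*} [CommRing R] (s : R →+* R) {x : R}
    (hx : ∀ a, x * a = 0 → a = 0) (hsx : s x = 0) (hs : ∀ a, ∃ b, a = s a + x * b)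
    {S : Set R} (hS : ∀ a ∈ S, s a = a) : RegularMod (Ideal.span S) x := by
  have key : ∀ k ∈ Ideal.span S, ∃ b ∈ Ideal.span S, k = s k + x * b := by
    intro k hk
    induction hk using Submodule.span_induction with
    | mem a ha => exact ⟨0, zero_mem _, by rw [hS a ha]; ring⟩
    | zero => exact ⟨0, zero_mem _, by simp⟩
    | add a b _ _ iha ihb =>
      obtain ⟨a', ha', ha⟩ := iha
      obtain ⟨b', hb', hb⟩ := ihb
      refine ⟨a' + b', add_mem ha' hb', ?_⟩
      rw [map_add]
      linear_combination ha + hb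
    | smul c a has iha =>
      obtain ⟨a', ha', ha⟩ := iha
      obtain ⟨c', hc⟩ := hs c
      refine ⟨c' * s a + c * a', ?_, ?_⟩
      · refine add_mem (Ideal.mul_mem_left _ _ ?_) (Ideal.mul_mem_left _ _ ha')
        rw [← sub_eq_of_eq_add ha]
        exact sub_mem has (Ideal.mul_mem_left _ _ ha')
      · rw [smul_eq_mul, map_mul]
        linear_combination c * ha + s a * hc
  intro f hf
  obtain ⟨b, hb, h⟩ := key _ hf
  rw [map_mul, hsx, zero_mul, zero_add] at h
  rw [sub_eq_zero.1 (hx (f - b) (by rw [mul_sub, h, sub_self]))]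
  exact hb

section Germs

variable {E E' : Type*} [NormedAddCommGroup E] [NormedSpace ℂ E]
  [NormedAddCommGroup E'] [NormedSpace ℂ E']

/-- The germ at `z` of a function analytic at `z`. -/
noncomputable def analyticGerm {z : E} (F : E → ℂ) (hF : AnalyticAt ℂ F z) : analyticGerms E z :=
  ⟨(F : Germ (𝓝 z) ℂ), F, hF, rfl⟩

theorem exists_eq_analyticGerm {z : E} (a : analyticGerms E z) :
    ∃ F, ∃ hF : AnalyticAt ℂ F z, a = analyticGerm F hF := by
  obtain ⟨_, F, hF, rfl⟩ := a
  exact ⟨F, hF, rfl⟩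

/-- The value at `z` of a germ of analytic functions at `z`. -/
noncomputable def analyticGermValue (z : E) : analyticGerms E z →+* ℂ :=
  Germ.valueRingHom.comp (analyticGerms E z).subtype

theorem isUnit_of_analyticGermValue_ne_zero {z : E} {a : analyticGerms E z}
    (ha : analyticGermValue z a ≠ 0) : IsUnit a := by
  obtain ⟨F, hF, rfl⟩ := exists_eq_analyticGerm a
  have hz : F z ≠ 0 := ha
  refine .of_mul_eq_one (analyticGerm F⁻¹ (hF.inv hz)) (Subtype.ext (Germ.coe_eq.2 ?_))
  filter_upwards [hF.continuousAt.eventually_ne hz] with x hx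
  exact mul_inv_cancel₀ hx

instance isLocalRing_analyticGerms (z : E) : IsLocalRing (analyticGerms E z) :=
  have : Nontrivial (analyticGerms E z) := (analyticGermValue z).domain_nontrivial
  .of_isUnit_or_isUnit_one_sub_self fun a => by
    by_cases ha : analyticGermValue z a = 0
    · exact Or.inr (isUnit_of_analyticGermValue_ne_zero (by simp [ha]))
    · exact Or.inl (isUnit_of_analyticGermValue_ne_zero ha)

theorem mem_maximalIdeal_of_analyticGermValue_eq_zero {z : E} {a : analyticGerms E z}
    (ha : analyticGermValue z a = 0) : a ∈ IsLocalRing.maximalIdeal (analyticGerms E z) :=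
  fun h => (h.map (analyticGermValue z)).ne_zero ha

/-- Composition with a map analytic at `z`, as a homomorphism of rings of germs. -/
noncomputable def pullbackGerms {z : E} {z' : E'} (ψ : E → E') (hψ : AnalyticAt ℂ ψ z)
    (hz : ψ z = z') : analyticGerms E' z' →+* analyticGerms E z where
  toFun a := ⟨a.1.compTendsto ψ (by rw [← hz]; exact hψ.continuousAt), by
    obtain ⟨_, F, hF, rfl⟩ := a
    subst hz
    exact ⟨F ∘ ψ, hF.comp hψ, rfl⟩⟩
  map_one' := rfl
  map_zero' := rfl
  map_add' a b := by
    obtain ⟨_, F, hF, rfl⟩ := a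
    obtain ⟨_, G, hG, rfl⟩ := b
    rfl
  map_mul' a b := by
    obtain ⟨_, F, hF, rfl⟩ := a
    obtain ⟨_, G, hG, rfl⟩ := b
    rfl

theorem map_pullbackGerms_span {z : E} {z' : E'} (ψ : E → E') (hψ : AnalyticAt ℂ ψ z)
    (hz : ψ z = z') {ι : Type*} {g : ι → E' → ℂ} (hg : ∀ i, AnalyticAt ℂ (g i) z') :
    (Ideal.span {γ : analyticGerms E' z' | ∃ i, (γ : Germ (𝓝 z') ℂ) = (g i : Germ (𝓝 z') ℂ)}).map
        (pullbackGerms ψ hψ hz)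
      = Ideal.span {γ : analyticGerms E z | ∃ i, (γ : Germ (𝓝 z) ℂ)
          = ((g i ∘ ψ : E → ℂ) : Germ (𝓝 z) ℂ)} := by
  rw [Ideal.map_span]
  congr 1
  ext γ
  constructor
  · rintro ⟨⟨_, h⟩, ⟨i, rfl⟩, rfl⟩
    exact ⟨i, rfl⟩
  · rintro ⟨i, hi⟩
    exact ⟨analyticGerm (g i) (hg i), ⟨i, rfl⟩, Subtype.ext hi.symm⟩

end Germs

section Coordinates

variable {σ : Type*} [Fintype σ]

theorem analyticAt_coordinate (j : σ) (z : σ → ℂ) : AnalyticAt ℂ (fun x : σ → ℂ => x j) z :=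
  (ContinuousLinearMap.proj (R := ℂ) (φ := fun _ : σ => ℂ) j).analyticAt z

/-- The germ at the origin of a coordinate function. -/
noncomputable def coordinateGerm (j : σ) : analyticGerms (σ → ℂ) 0 :=
  analyticGerm (fun x => x j) (analyticAt_coordinate j 0)

theorem coordinateGerm_mem_maximalIdeal (j : σ) :
    coordinateGerm j ∈ IsLocalRing.maximalIdeal (analyticGerms (σ → ℂ) 0) :=
  mem_maximalIdeal_of_analyticGermValue_eq_zero rfl

theorem eq_zero_of_coordinateGerm_mul_eq_zero (j : σ) (a : analyticGerms (σ → ℂ) 0)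
    (ha : coordinateGerm j * a = 0) : a = 0 := by
  classical
  obtain ⟨F, hF, rfl⟩ := exists_eq_analyticGerm a
  have h : ∀ᶠ x : σ → ℂ in 𝓝 0, x j * F x = 0 := Germ.coe_eq.1 (congrArg Subtype.val ha)
  refine Subtype.ext (Germ.coe_eq.2 ?_)
  filter_upwards [h.eventually_nhds, hF.eventually_analyticAt] with z hz hFz
  by_cases hj : z j = 0
  · have hpath : Tendsto (fun t : ℂ => Function.update z j t) (𝓝 0) (𝓝 z) := by
      have hc : Continuous fun t : ℂ => Function.update z j t :=
        continuous_const.update j continuous_id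
      have := hc.tendsto 0
      rwa [← hj, Function.update_eq_self, hj] at this
    have hlim : Tendsto (fun t : ℂ => F (Function.update z j t)) (𝓝[≠] 0) (𝓝 (F z)) :=
      (hFz.continuousAt.tendsto.comp hpath).mono_left nhdsWithin_le_nhds
    refine tendsto_nhds_unique_of_eventuallyEq hlim (tendsto_const_nhds (x := (0 : ℂ))) ?_
    filter_upwards [nhdsWithin_le_nhds (hpath.eventually hz), self_mem_nhdsWithin] with t ht ht0
    rw [Function.update_self] at ht
    exact (mul_eq_zero.1 ht).resolve_left ht0
  · exact (mul_eq_zero.1 hz.self_of_nhds).resolve_left hj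

variable [DecidableEq σ]

theorem analyticAt_update (j : σ) (z : σ → ℂ) :
    AnalyticAt ℂ (fun x : σ → ℂ => Function.update x j 0) z := by
  refine analyticAt_pi_iff.2 fun i => ?_
  by_cases hi : i = j
  · subst hi
    simpa using analyticAt_const
  · simpa [Function.update_of_ne hi] using analyticAt_coordinate i z

/-- Restriction of germs to a coordinate hyperplane, extended back to the whole space. -/
noncomputable def restrictCoordinate (j : σ) :
    analyticGerms (σ → ℂ) 0 →+* analyticGerms (σ → ℂ) 0 :=
  pullbackGerms (fun x => Function.update x j 0) (analyticAt_update j 0) (by simp)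

theorem restrictCoordinate_coordinateGerm_self (j : σ) :
    restrictCoordinate j (coordinateGerm j) = 0 :=
  Subtype.ext (Germ.coe_eq.2 (Eventually.of_forall fun x => by simp))

theorem restrictCoordinate_coordinateGerm_of_ne {i j : σ} (h : i ≠ j) :
    restrictCoordinate j (coordinateGerm i) = coordinateGerm i :=
  Subtype.ext (Germ.coe_eq.2 (Eventually.of_forall fun x => by simp [Function.update_of_ne h]))

theorem exists_eq_restrictCoordinate_add_mul (j : σ) (a : analyticGerms (σ → ℂ) 0) :
    ∃ b, a = restrictCoordinate j a + coordinateGerm j * b := by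
  obtain ⟨F, hF, rfl⟩ := exists_eq_analyticGerm a
  obtain ⟨G, hG, h⟩ := exists_eq_update_add_mul j hF
  exact ⟨analyticGerm G hG, Subtype.ext (Germ.coe_eq.2 h)⟩

theorem regularSeqMod_coordinateGerm {T : List σ} (hT : T.Nodup) :
    ∀ {S : Set (analyticGerms (σ → ℂ) 0)}, (∀ j ∈ T, ∀ a ∈ S, restrictCoordinate j a = a) →
      RegularSeqMod (Ideal.span S) (T.map coordinateGerm) := by
  induction T with
  | nil => intros; trivial
  | cons j T ih =>
    intro S hS
    obtain ⟨hj, hT⟩ := List.nodup_cons.1 hT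
    refine ⟨regularMod_span_of_retraction (restrictCoordinate j)
      (eq_zero_of_coordinateGerm_mul_eq_zero j) (restrictCoordinate_coordinateGerm_self j)
      (exists_eq_restrictCoordinate_add_mul j) (hS j List.mem_cons_self), ?_⟩
    rw [← Ideal.span_union]
    refine ih hT fun i hi a ha => ?_
    rcases ha with ha | rfl
    · exact hS i (List.mem_cons_of_mem _ hi) a ha
    · exact restrictCoordinate_coordinateGerm_of_ne fun h => hj (h ▸ hi)

/-- The projection annihilating the coordinates in `T`. -/
def annihilateCoordinates (T : List σ) (x : σ → ℂ) : σ → ℂ := fun i => if i ∈ T then 0 else x i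

theorem analyticAt_annihilateCoordinates (T : List σ) (z : σ → ℂ) :
    AnalyticAt ℂ (annihilateCoordinates T) z := by
  refine analyticAt_pi_iff.2 fun i => ?_
  by_cases hi : i ∈ T
  · simpa [annihilateCoordinates, hi] using analyticAt_const
  · simpa [annihilateCoordinates, hi] using analyticAt_coordinate i z

theorem sub_pullbackGerms_annihilateCoordinates_mem (T : List σ) (a : analyticGerms (σ → ℂ) 0) :
    a - pullbackGerms (annihilateCoordinates T) (analyticAt_annihilateCoordinates T 0)
        (funext fun i => by simp [annihilateCoordinates]) a
      ∈ Ideal.ofList (T.map coordinateGerm) := by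
  obtain ⟨F, hF, rfl⟩ := exists_eq_analyticGerm a
  induction T with
  | nil =>
    rw [sub_eq_zero.2]
    · exact zero_mem _
    · refine Subtype.ext (Germ.coe_eq.2 (Eventually.of_forall fun x => congrArg F ?_))
      funext i
      simp [annihilateCoordinates]
  | cons j T ih =>
    set b := pullbackGerms (annihilateCoordinates T) (analyticAt_annihilateCoordinates T 0)
        (funext fun i => by simp [annihilateCoordinates]) (analyticGerm F hF) with hb
    have hcomp : pullbackGerms (annihilateCoordinates (j :: T))
        (analyticAt_annihilateCoordinates (j :: T) 0)
        (funext fun i => by simp [annihilateCoordinates]) (analyticGerm F hF)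
          = restrictCoordinate j b := by
      refine Subtype.ext (Germ.coe_eq.2 (Eventually.of_forall fun x => congrArg F ?_))
      funext i
      by_cases hi : i = j
      · subst hi; simp [annihilateCoordinates]
      · simp [annihilateCoordinates, hi]
    obtain ⟨c, hc⟩ := exists_eq_restrictCoordinate_add_mul j b
    rw [hcomp, List.map_cons, Ideal.ofList_cons, ← sub_add_sub_cancel _ b]
    refine add_mem (Ideal.mem_sup_right ih) (Ideal.mem_sup_left ?_)
    rw [sub_eq_of_eq_add' hc]
    exact Ideal.mul_mem_right _ _ (Ideal.mem_span_singleton_self _)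

theorem ker_pullbackGerms_of_comp_eq {E : Type*} [NormedAddCommGroup E] [NormedSpace ℂ E]
    {z : E} {χ : E → σ → ℂ} (hχ : AnalyticAt ℂ χ z) (hz : χ z = 0) {p : (σ → ℂ) → E}
    (hp : AnalyticAt ℂ p 0) (hp0 : p 0 = z) {T : List σ}
    (hcomp : ∀ x, χ (p x) = annihilateCoordinates T x) (hT : ∀ e, ∀ j ∈ T, χ e j = 0) :
    RingHom.ker (pullbackGerms χ hχ hz) = Ideal.ofList (T.map coordinateGerm) := by
  refine le_antisymm (fun a ha => ?_) (Ideal.span_le.2 fun a ha => ?_)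
  · have h := sub_pullbackGerms_annihilateCoordinates_mem T a
    have h0 : pullbackGerms (annihilateCoordinates T) (analyticAt_annihilateCoordinates T 0)
        (funext fun i => by simp [annihilateCoordinates]) a
          = pullbackGerms p hp hp0 (pullbackGerms χ hχ hz a) := by
      obtain ⟨F, hF, rfl⟩ := exists_eq_analyticGerm a
      exact Subtype.ext (Germ.coe_eq.2 (Eventually.of_forall fun x => congrArg F (hcomp x).symm))
    rwa [h0, (RingHom.mem_ker).1 ha, map_zero, sub_zero] at h
  · obtain ⟨j, hj, rfl⟩ := List.mem_map.1 ha
    exact Subtype.ext (Germ.coe_eq.2 (Eventually.of_forall fun e => hT e j hj))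

end Coordinates

section Graph

variable {m r : ℕ}

theorem analyticAt_sumElim {E : Type*} [NormedAddCommGroup E] [NormedSpace ℂ E] {z : E}
    {α : E → Fin m → ℂ} {β : E → Fin r → ℂ} (hα : AnalyticAt ℂ α z) (hβ : AnalyticAt ℂ β z) :
    AnalyticAt ℂ (fun x => Sum.elim (α x) (β x)) z :=
  analyticAt_pi_iff.2 fun i => by
    cases i with
    | inl i => exact analyticAt_pi_iff.1 hα i
    | inr i => exact analyticAt_pi_iff.1 hβ i

theorem analyticAt_comp_inl (z : Fin m ⊕ Fin r → ℂ) :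
    AnalyticAt ℂ (fun x : Fin m ⊕ Fin r → ℂ => x ∘ Sum.inl) z :=
  analyticAt_pi_iff.2 fun i => analyticAt_coordinate (Sum.inl i) z

theorem analyticAt_comp_inr (z : Fin m ⊕ Fin r → ℂ) :
    AnalyticAt ℂ (fun x : Fin m ⊕ Fin r → ℂ => x ∘ Sum.inr) z :=
  analyticAt_pi_iff.2 fun i => analyticAt_coordinate (Sum.inr i) z

/-- Pullback of germs along the projection of a product to its second factor. -/
noncomputable def pullbackSnd (m r : ℕ) :
    analyticGerms (Fin r → ℂ) 0 →+* analyticGerms (Fin m ⊕ Fin r → ℂ) 0 :=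
  pullbackGerms (fun x => x ∘ Sum.inr) (analyticAt_comp_inr 0) rfl

/-- Restriction of germs on a product to the first factor. -/
noncomputable def restrictFst (m r : ℕ) :
    analyticGerms (Fin m ⊕ Fin r → ℂ) 0 →+* analyticGerms (Fin m → ℂ) 0 :=
  pullbackGerms (fun x => Sum.elim x 0) (analyticAt_sumElim analyticAt_id analyticAt_const)
    Sum.elim_zero_zero

/-- Restriction of germs on a product to the second factor. -/
noncomputable def restrictSnd (m r : ℕ) :
    analyticGerms (Fin m ⊕ Fin r → ℂ) 0 →+* analyticGerms (Fin r → ℂ) 0 :=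
  pullbackGerms (fun y => Sum.elim 0 y) (analyticAt_sumElim analyticAt_const analyticAt_id)
    Sum.elim_zero_zero

theorem ker_restrictFst : RingHom.ker (restrictFst m r)
    = Ideal.ofList (((List.finRange r).map Sum.inr).map coordinateGerm) :=
  ker_pullbackGerms_of_comp_eq _ _ (analyticAt_comp_inl 0) rfl
    (fun x => by funext i; cases i <;> simp [annihilateCoordinates]) (by simp)

theorem ker_restrictSnd : RingHom.ker (restrictSnd m r)
    = Ideal.ofList (((List.finRange m).map Sum.inl).map coordinateGerm) :=
  ker_pullbackGerms_of_comp_eq _ _ (analyticAt_comp_inr 0) rfl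
    (fun x => by funext i; cases i <;> simp [annihilateCoordinates]) (by simp)

theorem restrictSnd_pullbackSnd (a : analyticGerms (Fin r → ℂ) 0) :
    restrictSnd m r (pullbackSnd m r a) = a := by
  obtain ⟨F, hF, rfl⟩ := exists_eq_analyticGerm a
  rfl

theorem restrictSnd_surjective : Function.Surjective (restrictSnd m r) :=
  fun a => ⟨_, restrictSnd_pullbackSnd a⟩

/-- The pullback of germs along the shear `(x, y) ↦ (x, y + φ x)`. -/
noncomputable def shearGerms {φ : (Fin m → ℂ) → Fin r → ℂ} (hφ : AnalyticAt ℂ φ 0)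
    (hφ0 : φ 0 = 0) :
    analyticGerms (Fin m ⊕ Fin r → ℂ) 0 →+* analyticGerms (Fin m ⊕ Fin r → ℂ) 0 :=
  pullbackGerms (fun x => Sum.elim (x ∘ Sum.inl) (x ∘ Sum.inr + φ (x ∘ Sum.inl)))
    (analyticAt_sumElim (analyticAt_comp_inl 0)
      ((analyticAt_comp_inr 0).add (hφ.comp_of_eq (analyticAt_comp_inl 0) rfl)))
    (by
      rw [show (0 : Fin m ⊕ Fin r → ℂ) ∘ Sum.inl = 0 from rfl,
        show (0 : Fin m ⊕ Fin r → ℂ) ∘ Sum.inr = 0 from rfl, hφ0, add_zero, Sum.elim_zero_zero])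

variable {φ : (Fin m → ℂ) → Fin r → ℂ} (hφ : AnalyticAt ℂ φ 0) (hφ0 : φ 0 = 0)

theorem shearGerms_comp_neg {φ' : (Fin m → ℂ) → Fin r → ℂ} (hφ' : AnalyticAt ℂ φ' 0)
    (hφ'0 : φ' 0 = 0) (h : φ' + φ = 0) (a : analyticGerms (Fin m ⊕ Fin r → ℂ) 0) :
    shearGerms hφ hφ0 (shearGerms hφ' hφ'0 a) = a := by
  obtain ⟨F, hF, rfl⟩ := exists_eq_analyticGerm a
  refine Subtype.ext (Germ.coe_eq.2 (Eventually.of_forall fun x => congrArg F ?_))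
  funext i
  cases i with
  | inl i => rfl
  | inr i =>
    have := congrFun (congrFun h (x ∘ Sum.inl)) i
    simp only [Pi.add_apply, Pi.zero_apply] at this
    simp only [Function.comp_def, Sum.elim_inr, Sum.elim_inl, Pi.add_apply] at this ⊢
    linear_combination this

theorem restrictFst_comp_shearGerms_surjective :
    Function.Surjective ((restrictFst m r).comp (shearGerms hφ hφ0)) := fun a => by
  refine ⟨pullbackGerms (fun x => x ∘ Sum.inl) (analyticAt_comp_inl 0) rfl a, ?_⟩
  obtain ⟨F, hF, rfl⟩ := exists_eq_analyticGerm a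
  rfl

theorem exists_ker_restrictFst_comp_shearGerms :
    ∃ ys : List (analyticGerms (Fin m ⊕ Fin r → ℂ) 0), ys.length = r ∧
      RingHom.ker ((restrictFst m r).comp (shearGerms hφ hφ0)) = Ideal.ofList ys := by
  have hφ' : AnalyticAt ℂ (-φ) 0 := hφ.neg
  have hφ'0 : (-φ) 0 = 0 := by simp [hφ0]
  refine ⟨(((List.finRange r).map Sum.inr).map coordinateGerm).map (shearGerms hφ' hφ'0),
    by simp, ?_⟩
  rw [← Ideal.map_ofList, ← RingHom.comap_ker, ker_restrictFst]
  refine le_antisymm (fun a ha => ?_) (Ideal.map_le_iff_le_comap.2 fun a ha => ?_)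
  · rw [← shearGerms_comp_neg hφ' hφ'0 hφ hφ0 (by simp) a]
    exact Ideal.mem_map_of_mem _ ha
  · rw [Ideal.mem_comap, Ideal.mem_comap,
      shearGerms_comp_neg hφ hφ0 hφ' hφ'0 (by simp) a]
    exact ha

theorem regularSeqMod_map_pullbackSnd {ι : Type*} {g : ι → (Fin r → ℂ) → ℂ}
    (hg : ∀ i, AnalyticAt ℂ (g i) 0) :
    RegularSeqMod ((Ideal.span {γ : analyticGerms (Fin r → ℂ) 0 | ∃ i,
        (γ : Germ (𝓝 (0 : Fin r → ℂ)) ℂ) = (g i : Germ (𝓝 (0 : Fin r → ℂ)) ℂ)}).map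
          (pullbackSnd m r))
      (((List.finRange m).map Sum.inl).map coordinateGerm) := by
  rw [pullbackSnd, map_pullbackGerms_span _ _ _ hg]
  refine regularSeqMod_coordinateGerm ((List.nodup_finRange m).map Sum.inl_injective) ?_
  rintro j hj ⟨_, h⟩ ⟨i, rfl⟩
  obtain ⟨j, -, rfl⟩ := List.mem_map.1 hj
  refine Subtype.ext (Germ.coe_eq.2 (Eventually.of_forall fun x => congrArg (g i) ?_))
  funext k
  simp

theorem map_restrictFst_comp_shearGerms {ι : Type*} {g : ι → (Fin r → ℂ) → ℂ}
    (hg : ∀ i, AnalyticAt ℂ (g i) 0) :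
    ((Ideal.span {γ : analyticGerms (Fin r → ℂ) 0 | ∃ i,
        (γ : Germ (𝓝 (0 : Fin r → ℂ)) ℂ) = (g i : Germ (𝓝 (0 : Fin r → ℂ)) ℂ)}).map
          (pullbackSnd m r)).map ((restrictFst m r).comp (shearGerms hφ hφ0))
      = Ideal.span {γ : analyticGerms (Fin m → ℂ) 0 | ∃ i, (γ : Germ (𝓝 (0 : Fin m → ℂ)) ℂ)
          = ((g i ∘ φ : (Fin m → ℂ) → ℂ) : Germ (𝓝 (0 : Fin m → ℂ)) ℂ)} := by
  rw [← map_pullbackGerms_span φ hφ hφ0 hg, Ideal.map_map]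
  congr 1
  refine RingHom.ext fun a => ?_
  obtain ⟨F, hF, rfl⟩ := exists_eq_analyticGerm a
  refine Subtype.ext (Germ.coe_eq.2 (Eventually.of_forall fun x => congrArg F ?_))
  funext k
  exact zero_add _

end Graph

/-- Let `φ : (ℂᵐ,0) → (ℂʳ,0)` be a holomorphic map germ, `I` an ideal of `O_r` generated
by germs `g i`, and `J = φ*(I)` the ideal of `O_m` generated by the pullbacks `g i ∘ φ`.
If `O_r/I` is Cohen–Macaulay and `codim V(I) = codim V(J)`, i.e.
`r - dim (O_r/I) = m - dim (O_m/J)`, then `O_m/J` is Cohen–Macaulay. -/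
theorem cohenMacaulay_pullback_of_codim_eq (m r : ℕ)
    (φ : (Fin m → ℂ) → (Fin r → ℂ)) (hφ : AnalyticAt ℂ φ 0) (hφ0 : φ 0 = 0)
    (ι : Type) (g : ι → ((Fin r → ℂ) → ℂ)) (hg : ∀ i, AnalyticAt ℂ (g i) 0)
    (I : Ideal (analyticGerms (Fin r → ℂ) 0))
    (hI : I = Ideal.span {γ : analyticGerms (Fin r → ℂ) 0 | ∃ i : ι,
      (γ : Filter.Germ (nhds (0 : Fin r → ℂ)) ℂ)
        = ((g i) : Filter.Germ (nhds (0 : Fin r → ℂ)) ℂ)})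
    (J : Ideal (analyticGerms (Fin m → ℂ) 0))
    (hJ : J = Ideal.span {γ : analyticGerms (Fin m → ℂ) 0 | ∃ i : ι,
      (γ : Filter.Germ (nhds (0 : Fin m → ℂ)) ℂ)
        = ((g i ∘ φ) : Filter.Germ (nhds (0 : Fin m → ℂ)) ℂ)})
    (hCM : IsCohenMacaulayRing ((analyticGerms (Fin r → ℂ) 0) ⧸ I))
    (dI dJ : ℕ)
    (hdI : ringKrullDim ((analyticGerms (Fin r → ℂ) 0) ⧸ I) = (dI : WithBot (WithTop ℕ)))
    (hdJ : ringKrullDim ((analyticGerms (Fin m → ℂ) 0) ⧸ J) = (dJ : WithBot (WithTop ℕ)))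
    (hcodim : (r : ℤ) - dI = (m : ℤ) - dJ) :
    IsCohenMacaulayRing ((analyticGerms (Fin m → ℂ) 0) ⧸ J) := by
  subst hI hJ
  have := isNoetherianRing_analyticGerms (σ := Fin m ⊕ Fin r)
  obtain ⟨ys, hlen, hker⟩ := exists_ker_restrictFst_comp_shearGerms hφ hφ0
  set I := Ideal.span {γ : analyticGerms (Fin r → ℂ) 0 | ∃ i : ι,
    (γ : Filter.Germ (nhds (0 : Fin r → ℂ)) ℂ)
      = ((g i) : Filter.Germ (nhds (0 : Fin r → ℂ)) ℂ)}
  have hI : (I.map (pullbackSnd m r)).map (restrictSnd m r) = I := by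
    rw [Ideal.map_map, show (restrictSnd m r).comp (pullbackSnd m r) = RingHom.id _ from
      RingHom.ext restrictSnd_pullbackSnd, Ideal.map_id]
  have hys : ∀ y ∈ ys, y ∈ IsLocalRing.maximalIdeal (analyticGerms (Fin m ⊕ Fin r → ℂ) 0) :=
    fun y hy => IsLocalRing.le_maximalIdeal (RingHom.ker_ne_top _)
      (hker.ge (Ideal.subset_span hy))
  have hxs : ∀ x ∈ ((List.finRange m).map (Sum.inl (β := Fin r))).map coordinateGerm,
      x ∈ IsLocalRing.maximalIdeal (analyticGerms (Fin m ⊕ Fin r → ℂ) 0) := by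
    intro x hx
    obtain ⟨j, -, rfl⟩ := List.mem_map.1 hx
    exact coordinateGerm_mem_maximalIdeal j
  rw [← map_restrictFst_comp_shearGerms hφ hφ0 hg] at hdJ ⊢
  rw [← hI] at hdI hCM
  refine isCohenMacaulayRing_quotient_map restrictSnd_surjective
    (restrictFst_comp_shearGerms_surjective hφ hφ0) ker_restrictSnd hker hxs hys
    (regularSeqMod_map_pullbackSnd hg) hdI hdJ ?_ hCM
  simp only [List.length_map, List.length_finRange]
  omega
end

section
/- Let f : (C^n,0) → (C^p,0) be a holomorphic map germ of corank k. Then Mond's double point ideal satisfies: I^2(f) ⊆ H^2(f), and H^2(f)^k ⊆ I^2(f), where H^2(f) = P(f,2) : I_Δ is the transporter ideal of the pullback of the target diagonal ideal by the source diagonal ideal. In particular if corank f = 1 then I^2(f) = H^2(f). -/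
open Filter Topology

/-- Mond's double point ideal `I²(f)` in the local ring `O_{2n}` of holomorphic germs at
the origin of `ℂⁿ × ℂⁿ`, formed from a matrix `α` with `f(x)-f(x') = α(x,x')(x-x')`:
it is generated by the germs of the components `fⱼ(x) - fⱼ(x')` together with the
`n × n` minors of `α`. -/
noncomputable def mondDoubleIdeal (n p : ℕ) (f : (Fin n → ℂ) → (Fin p → ℂ))
    (α : Fin p → Fin n → ((Fin n → ℂ) × (Fin n → ℂ)) → ℂ) :
    Ideal (analyticGerms ((Fin n → ℂ) × (Fin n → ℂ)) (0, 0)) :=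
  Ideal.span
    ({γ | ∃ j : Fin p, (γ : Filter.Germ (nhds ((0, 0) : (Fin n → ℂ) × (Fin n → ℂ))) ℂ)
          = ((fun w : (Fin n → ℂ) × (Fin n → ℂ) => f w.1 j - f w.2 j) : Filter.Germ (nhds ((0, 0) : (Fin n → ℂ) × (Fin n → ℂ))) ℂ)}
      ∪ {γ | ∃ rows : Fin n → Fin p, StrictMono rows ∧
          (γ : Filter.Germ (nhds ((0, 0) : (Fin n → ℂ) × (Fin n → ℂ))) ℂ)
          = ((fun w : (Fin n → ℂ) × (Fin n → ℂ) => (Matrix.of fun i i' : Fin n => α (rows i) i' w).det) :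
              Filter.Germ (nhds ((0, 0) : (Fin n → ℂ) × (Fin n → ℂ))) ℂ)})


/-- The pullback `P(f,2)` of the ideal of the target diagonal: the ideal of `O_{2n}`
generated by the germs of the components `fⱼ(x) - fⱼ(x')`. -/
noncomputable def pullbackDiagIdeal (n p : ℕ) (f : (Fin n → ℂ) → (Fin p → ℂ)) :
    Ideal (analyticGerms ((Fin n → ℂ) × (Fin n → ℂ)) (0, 0)) :=
  Ideal.span {γ | ∃ j : Fin p,
    (γ : Filter.Germ (nhds ((0, 0) : (Fin n → ℂ) × (Fin n → ℂ))) ℂ)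
      = ((fun w : (Fin n → ℂ) × (Fin n → ℂ) => f w.1 j - f w.2 j) :
          Filter.Germ (nhds ((0, 0) : (Fin n → ℂ) × (Fin n → ℂ))) ℂ)}

/-- The ideal `I_Δ` of the source diagonal in `O_{2n}`, generated by the germs of the
coordinate differences `xᵢ - x'ᵢ`. -/
noncomputable def sourceDiagIdeal (n : ℕ) :
    Ideal (analyticGerms ((Fin n → ℂ) × (Fin n → ℂ)) (0, 0)) :=
  Ideal.span {γ | ∃ i : Fin n,
    (γ : Filter.Germ (nhds ((0, 0) : (Fin n → ℂ) × (Fin n → ℂ))) ℂ)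
      = ((fun w : (Fin n → ℂ) × (Fin n → ℂ) => w.1 i - w.2 i) :
          Filter.Germ (nhds ((0, 0) : (Fin n → ℂ) × (Fin n → ℂ))) ℂ)}


open Matrix in
/-- The determinant of a product `B * A` lies in every ideal containing the maximal minors
of `A`. -/
theorem Ideal.det_mul_mem_of_minors_mem {R : Type*} [CommRing R] {n p : ℕ} (I : Ideal R)
    (B : Matrix (Fin n) (Fin p) R) (A : Matrix (Fin p) (Fin n) R)
    (h : ∀ rows : Fin n → Fin p, StrictMono rows → (A.submatrix rows id).det ∈ I) :
    (B * A).det ∈ I := by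
  have hall : ∀ ρ : Fin n → Fin p, (A.submatrix ρ id).det ∈ I := by
    intro ρ
    by_cases hρ : Function.Injective ρ
    · have hmono : StrictMono (ρ ∘ Tuple.sort ρ) :=
        (Tuple.monotone_sort ρ).strictMono_of_injective (hρ.comp (Tuple.sort ρ).injective)
      have hdet := h _ hmono
      have hperm : A.submatrix (ρ ∘ Tuple.sort ρ) id
          = (A.submatrix ρ id).submatrix (Tuple.sort ρ) id := rfl
      rw [hperm, det_permute] at hdet
      have hsign := I.mul_mem_left ((Equiv.Perm.sign (Tuple.sort ρ) : ℤ) : R) hdet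
      rwa [← mul_assoc, ← Int.cast_mul, ← Units.val_mul, Int.units_mul_self, Units.val_one,
        Int.cast_one, one_mul] at hsign
    · obtain ⟨a, b, hab, hne⟩ : ∃ a b, ρ a = ρ b ∧ a ≠ b := by
        simpa [Function.Injective] using hρ
      rw [det_zero_of_row_eq hne (by ext; simp [hab])]
      exact I.zero_mem
  have hrows : B * A = fun i => ∑ j, B i j • A j := by
    ext i c
    simp [mul_apply]
  have hexp : (B * A).det = ∑ ρ : Fin n → Fin p, (∏ i, B i (ρ i)) • (A.submatrix ρ id).det := by
    rw [hrows]
    refine (detRowAlternating.toMultilinearMap.map_sum _).trans (Finset.sum_congr rfl fun ρ _ => ?_)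
    exact detRowAlternating.toMultilinearMap.map_smul_univ _ _
  rw [hexp]
  exact I.sum_mem fun ρ _ => I.mul_mem_left _ (hall ρ)

/-- The submodule of Koszul (trivial) relations between the entries of `y`. -/
def koszulRelations {R ι : Type*} [CommRing R] [DecidableEq ι] (y : ι → R) :
    Submodule R (ι → R) :=
  Submodule.span R {v | ∃ a b, v = y a • Pi.single b 1 - y b • Pi.single a 1}

section Koszul

open Matrix

variable {R ι : Type*} [CommRing R] [Fintype ι] [DecidableEq ι]

/-- If one row of a matrix is a Koszul relation of `y` and the products of the other rows with
`y` lie in `J`, then so does the determinant. -/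
theorem Ideal.det_updateRow_mem_of_mem_koszulRelations (J : Ideal R) (y : ι → R)
    (M : Matrix ι ι R) (s : ι) (h : ∀ i, i ≠ s → M i ⬝ᵥ y ∈ J) {v : ι → R}
    (hv : v ∈ koszulRelations y) : (M.updateRow s v).det ∈ J := by
  let L : (ι → R) →ₗ[R] R := (detRowAlternating (R := R) (n := ι)).toMultilinearMap.toLinearMap M s
  have hL : ∀ v, L v = (M.updateRow s v).det := fun _ => rfl
  suffices hle : koszulRelations y ≤ Submodule.comap L J from hL v ▸ hle hv
  refine Submodule.span_le.mpr ?_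
  rintro _ ⟨a, b, rfl⟩
  rw [SetLike.mem_coe, Submodule.mem_comap, map_sub, map_smul, map_smul, hL, hL]
  have hcramer : adjugate (M.updateRow s (Pi.single b 1)) *ᵥ
      ((M.updateRow s (Pi.single b 1)) *ᵥ y) = (M.updateRow s (Pi.single b 1)).det • y := by
    rw [mulVec_mulVec, adjugate_mul, smul_mulVec, one_mulVec]
  have hsplit : (M.updateRow s (Pi.single b 1)) *ᵥ y
      = y b • Pi.single s 1 + fun i => if i = s then 0 else M i ⬝ᵥ y := by
    ext i
    by_cases hi : i = s
    · subst hi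
      simp [mulVec]
    · simp [mulVec, hi]
  have happ := congrFun hcramer a
  rw [hsplit, mulVec_add, mulVec_smul, Pi.add_apply, Pi.smul_apply, mulVec_single_one, col_apply,
    adjugate_apply, updateRow_idem, Pi.smul_apply, smul_eq_mul, smul_eq_mul] at happ
  rw [smul_eq_mul, smul_eq_mul, mul_comm, ← happ, add_sub_cancel_left]
  refine J.sum_mem fun i _ => J.mul_mem_left _ ?_
  dsimp only
  split_ifs with hi
  exacts [J.zero_mem, h i hi]

theorem dotProduct_eq_zero_of_mem_koszulRelations (y : ι → R) {v : ι → R}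
    (hv : v ∈ koszulRelations y) : v ⬝ᵥ y = 0 := by
  induction hv using Submodule.span_induction with
  | mem v hv =>
    obtain ⟨a, b, rfl⟩ := hv
    simp [sub_dotProduct, mul_comm]
  | zero => simp
  | add v w _ _ hv hw => rw [add_dotProduct, hv, hw, add_zero]
  | smul c v _ hv => rw [smul_dotProduct, hv, smul_zero]

/-- Modifying the rows of a matrix by Koszul relations of `y` does not change the determinant
modulo an ideal containing the products of the rows with `y`. -/
theorem Ideal.det_sub_det_mem_of_koszulRelations (J : Ideal R) (y : ι → R) (M N : Matrix ι ι R)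
    (h : ∀ i, N i ⬝ᵥ y ∈ J) (hMN : ∀ i, M i - N i ∈ koszulRelations y) :
    M.det - N.det ∈ J := by
  have hMy : ∀ i, M i ⬝ᵥ y ∈ J := fun i => by
    rw [← sub_add_cancel (M i) (N i), add_dotProduct,
      dotProduct_eq_zero_of_mem_koszulRelations y (hMN i), zero_add]
    exact h i
  let W : Finset ι → Matrix ι ι R := fun s => Matrix.of fun i j => if i ∈ s then M i j else N i j
  have hWmem : ∀ s i, i ∈ s → W s i = M i := fun s i hi => by ext j; simp [W, hi]
  have hWnotMem : ∀ s i, i ∉ s → W s i = N i := fun s i hi => by ext j; simp [W, hi]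
  have key : ∀ s : Finset ι, (W s).det - N.det ∈ J := by
    intro s
    induction s using Finset.induction_on with
    | empty =>
      rw [show W ∅ = N from funext fun i => hWnotMem ∅ i (Finset.notMem_empty i), sub_self]
      exact J.zero_mem
    | insert a s ha ih =>
      have hN : (W s).updateRow a (N a) = W s := by
        rw [← hWnotMem s a ha, updateRow_eq_self]
      have hM : (W s).updateRow a (M a) = W (insert a s) := by
        ext i j
        by_cases hi : i = a
        · subst hi
          simp [W]
        · simp [W, hi]
      have hrow : (W (insert a s)).det - (W s).det = ((W s).updateRow a (M a - N a)).det := by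
        rw [sub_eq_iff_eq_add, ← hM, ← congrArg det hN, ← det_updateRow_add, sub_add_cancel]
      rw [← sub_add_sub_cancel _ (W s).det, hrow]
      refine J.add_mem (J.det_updateRow_mem_of_mem_koszulRelations y _ a (fun i _ => ?_) (hMN a)) ih
      by_cases hi : i ∈ s
      · exact hWmem s i hi ▸ hMy i
      · exact hWnotMem s i hi ▸ h i
  have huniv := key Finset.univ
  rwa [show W Finset.univ = M from funext fun i => hWmem _ i (Finset.mem_univ i)] at huniv

/-- If multiplication by `y a` is injective modulo `⟨y i : i ∈ s⟩` whenever `a ∉ s`, then every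
relation between the entries of `y` is a Koszul relation. -/
theorem mem_koszulRelations_of_dotProduct_eq_zero (y : ι → R)
    (hreg : ∀ (s : Finset ι) (a : ι), a ∉ s → ∀ r, r * y a ∈ Ideal.span (y '' s) →
      r ∈ Ideal.span (y '' s)) {v : ι → R} (hv : v ⬝ᵥ y = 0) : v ∈ koszulRelations y := by
  suffices hs : ∀ (s : Finset ι) (v : ι → R), (∀ i, i ∉ s → v i = 0) → v ⬝ᵥ y = 0 →
      v ∈ koszulRelations y from hs Finset.univ v (by simp) hv
  clear hv v
  intro s
  induction s using Finset.induction_on with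
  | empty =>
    intro v hv _
    rw [show v = 0 from funext fun i => hv i (Finset.notMem_empty i)]
    exact Submodule.zero_mem _
  | insert a s ha ih =>
    intro v hsupp hv
    have hsum : v a * y a + ∑ i ∈ s, v i * y i = 0 := by
      rw [← Finset.sum_insert (f := fun i => v i * y i) ha, ← hv]
      exact Finset.sum_subset (Finset.subset_univ _) fun i _ hi => by rw [hsupp i hi, zero_mul]
    have hmem : v a ∈ Ideal.span (y '' s) := by
      refine hreg s a ha _ ?_
      rw [eq_neg_of_add_eq_zero_left hsum]
      exact neg_mem (sum_mem fun i hi => Ideal.mul_mem_left _ _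
        (Ideal.subset_span (Set.mem_image_of_mem y hi)))
    obtain ⟨c, hc⟩ := (Submodule.mem_span_image_finset_iff_exists_fun' R).mp hmem
    let w : ι → R := ∑ i ∈ s, c i • (y i • Pi.single a 1 - y a • Pi.single i 1)
    have hw : w ∈ koszulRelations y := Submodule.sum_mem _ fun i _ => Submodule.smul_mem _ _
      (Submodule.subset_span ⟨i, a, rfl⟩)
    rw [← sub_add_cancel v w]
    refine Submodule.add_mem _ (ih _ (fun i hi => ?_) ?_) hw
    · by_cases hia : i = a
      · subst hia
        have hz : ∀ j ∈ s, (c j • (y j • Pi.single i 1 - y i • Pi.single j 1) : ι → R) i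
            = c j • y j := by
          intro j hj
          have hji : i ≠ j := fun e => hi (e ▸ hj)
          simp [hji]
        rw [Pi.sub_apply, show w i = _ from Finset.sum_apply _ _ _, Finset.sum_congr rfl hz, hc,
          sub_self]
      · have hz : ∀ j ∈ s, (c j • (y j • Pi.single a 1 - y a • Pi.single j 1) : ι → R) i = 0 := by
          intro j hj
          have hji : i ≠ j := fun e => hi (e ▸ hj)
          simp [hji, hia]
        rw [Pi.sub_apply, show w i = _ from Finset.sum_apply _ _ _, Finset.sum_eq_zero hz, sub_zero,
          hsupp i (by simp [hia, hi])]
    · rw [sub_dotProduct, hv, dotProduct_eq_zero_of_mem_koszulRelations y hw, sub_zero]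

end Koszul

/-- A matrix of rank `n - k` has `n - k` rows which together with `k` standard basis vectors form
an invertible matrix. -/
theorem Matrix.exists_det_ne_zero_of_rank_eq {K : Type*} [Field K] {n p k : ℕ} (hkn : k ≤ n)
    (A : Matrix (Fin p) (Fin n) K) (hA : A.rank = n - k) :
    ∃ φ : Fin n → Fin p ⊕ Fin n,
      (Matrix.of fun i => Sum.elim A (fun c => Pi.single c 1) (φ i)).det ≠ 0 ∧
      (Finset.univ.filter fun i => (φ i).isRight).card = k := by
  classical
  obtain ⟨s, -, -, hspan, hs⟩ := exists_linearIndepOn_extension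
    (linearIndepOn_empty K A.row) (Set.subset_univ _)
  have hspan_eq : Submodule.span K (Set.range A.row) = Submodule.span K (A.row '' s) :=
    le_antisymm (Submodule.span_le.mpr (Set.image_univ ▸ hspan))
      (Submodule.span_mono (Set.image_subset_range _ _))
  have hcard : Fintype.card s = n - k := by
    rw [← hA, A.rank_eq_finrank_span_row, hspan_eq, Set.image_eq_range]
    exact (finrank_span_eq_card hs).symm
  let V : Fin p ⊕ Fin n → Fin n → K := Sum.elim A (fun c => Pi.single c 1)
  have hVs : LinearIndepOn K V (Sum.inl '' s) := hs.image_of_comp Sum.inl V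
  obtain ⟨b, hbt, hsb, hbspan, hb⟩ := exists_linearIndepOn_extension
    hVs (Set.subset_union_left (t := Set.range Sum.inr))
  have htop : ⊤ ≤ Submodule.span K (Set.range fun x : b => V x) := by
    rw [← (Pi.basisFun K (Fin n)).span_eq]
    refine Submodule.span_le.mpr ?_
    rintro _ ⟨c, rfl⟩
    have := hbspan ⟨Sum.inr c, Or.inr ⟨c, rfl⟩, rfl⟩
    rw [Set.image_eq_range] at this
    rw [Pi.basisFun_apply]
    exact this
  have hbcard : Fintype.card b = n := by
    rw [← finrank_span_eq_card hb, top_le_iff.mp htop]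
    simp
  let e : Fin n ≃ b := (Fintype.equivFinOfCardEq hbcard).symm
  refine ⟨fun i => e i, ?_, ?_⟩
  · have hli : LinearIndependent K fun i => V (e i) := hb.comp e e.injective
    exact ((Matrix.isUnit_iff_isUnit_det _).mp
      (Matrix.linearIndependent_rows_iff_isUnit.mp hli)).ne_zero
  · have hleft : (Finset.univ.filter fun i => ¬ (e i : Fin p ⊕ Fin n).isRight).card = n - k := by
      rw [← hcard, ← Fintype.card_subtype]
      refine (Fintype.card_congr (Equiv.ofBijective (fun x : s =>
        (⟨e.symm ⟨Sum.inl x, hsb ⟨x, x.2, rfl⟩⟩, by simp⟩ :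
          {i // ¬ (e i : Fin p ⊕ Fin n).isRight})) ⟨?_, ?_⟩)).symm
      · intro x x' h
        simpa [Subtype.ext_iff] using h
      · rintro ⟨i, hi⟩
        rcases hbt (e i).2 with ⟨x, hx, hxe⟩ | ⟨c, hc⟩
        · refine ⟨⟨x, hx⟩, Subtype.ext ?_⟩
          rw [Equiv.symm_apply_eq]
          exact Subtype.ext hxe
        · exact absurd (by rw [← hc]; rfl) hi
    have htot := Finset.card_filter_add_card_filter_not (s := (Finset.univ : Finset (Fin n)))
      (p := fun i => (e i : Fin p ⊕ Fin n).isRight = true)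
    rw [hleft, Finset.card_univ, Fintype.card_fin] at htot
    change Finset.card (Finset.univ.filter fun i => (e i : Fin p ⊕ Fin n).isRight = true) = k
    omega

section TransporterIdeal

open Matrix

variable {R : Type*} [CommRing R] {n p : ℕ}

/-- Maximal minors of `A` transport `⟨y⟩` into the ideal generated by the entries of `A y`. -/
theorem Matrix.det_submatrix_mem_colon (A : Matrix (Fin p) (Fin n) R) (y : Fin n → R)
    (rows : Fin n → Fin p) :
    (A.submatrix rows id).det ∈
      (Ideal.span (Set.range (A *ᵥ y))).colon (Ideal.span (Set.range y) : Set R) := by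
  rw [Submodule.mem_colon_iff_le, ← Ideal.submodule_span_eq, Submodule.smul_span,
    Submodule.span_le]
  intro x hx
  obtain ⟨_, ⟨c, rfl⟩, rfl⟩ := Set.mem_smul_set.mp hx
  have hcramer : adjugate (A.submatrix rows id) *ᵥ ((A.submatrix rows id) *ᵥ y)
      = (A.submatrix rows id).det • y := by
    rw [mulVec_mulVec, adjugate_mul, smul_mulVec, one_mulVec]
  have hc := congrFun hcramer c
  rw [Pi.smul_apply] at hc
  change (A.submatrix rows id).det • y c ∈ _
  rw [← hc, SetLike.mem_coe, mulVec, dotProduct]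
  refine Ideal.sum_mem _ fun i _ => Ideal.mul_mem_left _ _ ?_
  exact Ideal.subset_span (Set.mem_range_self (f := A *ᵥ y) (rows i))

/-- If all relations between the entries of `y` are Koszul relations, and some rows of `A` together
with `k` standard basis vectors form an invertible matrix, then the `k`-th power of the
transporter ideal `⟨A y⟩ : ⟨y⟩` lies in every ideal containing the entries of `A y` and the
maximal minors of `A`. -/
theorem Matrix.colon_pow_le_of_minors_mem (A : Matrix (Fin p) (Fin n) R) (y : Fin n → R)
    (hy : ∀ v, v ⬝ᵥ y = 0 → v ∈ koszulRelations y) (φ : Fin n → Fin p ⊕ Fin n)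
    (hφ : IsUnit (Matrix.of fun i => Sum.elim A (fun c => Pi.single c 1) (φ i)).det)
    (I : Ideal R) (hI : Ideal.span (Set.range (A *ᵥ y)) ≤ I)
    (hminors : ∀ rows : Fin n → Fin p, StrictMono rows → (A.submatrix rows id).det ∈ I) :
    ((Ideal.span (Set.range (A *ᵥ y))).colon (Ideal.span (Set.range y) : Set R)) ^
      (Finset.univ.filter fun i => (φ i).isRight).card ≤ I := by
  set P := Ideal.span (Set.range (A *ᵥ y)) with hP
  set H := P.colon (Ideal.span (Set.range y) : Set R) with hH
  have hAy : ∀ b : Fin p → R, (b ᵥ* A) ⬝ᵥ y ∈ P := fun b => by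
    rw [← dotProduct_mulVec]
    exact P.sum_mem fun j _ => P.mul_mem_left _ (Ideal.subset_span ⟨j, rfl⟩)
  rw [← Finset.prod_const, show H = Ideal.span (H : Set R) from (Ideal.span_eq H).symm,
    Ideal.prod_span, Ideal.span_le]
  intro x hx
  obtain ⟨g, hg, rfl⟩ := (Set.mem_finsetProd _ _ _).mp hx
  let d : Fin n → R := fun i => if (φ i).isRight then g i else 1
  let V : Matrix (Fin n) (Fin n) R :=
    Matrix.of fun i => Sum.elim A (fun c => Pi.single c 1) (φ i)
  let M : Matrix (Fin n) (Fin n) R := Matrix.of fun i j => d i * V i j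
  have hM : M.det = (∏ i with (φ i).isRight, g i) * V.det := by
    rw [det_mul_column, Finset.prod_filter]
  have hrows : ∀ i, ∃ b : Fin p → R, M i - b ᵥ* A ∈ koszulRelations y := by
    intro i
    rcases hi : φ i with j | c
    · refine ⟨Pi.single j 1, ?_⟩
      have : M i = Pi.single j 1 ᵥ* A := by
        ext l
        simp only [M, V, d, hi, of_apply, Sum.isRight_inl, Bool.false_eq_true, if_false, one_mul,
          single_one_vecMul]
        rfl
      rw [this, sub_self]
      exact Submodule.zero_mem _
    · have hmem : g i * y c ∈ P := by
        have : g i ∈ H := hg (by simp [hi])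
        exact Submodule.mem_colon.mp this _ (Ideal.subset_span ⟨c, rfl⟩)
      obtain ⟨b, hb⟩ := Ideal.mem_span_range_iff_exists_fun.mp hmem
      refine ⟨b, hy _ ?_⟩
      have : M i ⬝ᵥ y = g i * y c := by
        have : M i = g i • Pi.single c 1 := by
          ext l
          simp only [M, V, d, hi, of_apply, Sum.isRight_inr, if_true, Pi.smul_apply, smul_eq_mul]
          rfl
        rw [this, smul_dotProduct, single_one_dotProduct, smul_eq_mul]
      rw [sub_dotProduct, this, ← hb, ← dotProduct_mulVec]
      exact sub_self _
  choose B hB using hrows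
  have hdiff := P.det_sub_det_mem_of_koszulRelations y M (Matrix.of B * A) (fun i => hAy (B i)) hB
  have hdet : M.det ∈ I := by
    rw [← sub_add_cancel M.det (Matrix.of B * A).det]
    exact I.add_mem (hI hdiff) (I.det_mul_mem_of_minors_mem _ _ hminors)
  rw [hM] at hdet
  exact (Ideal.mul_unit_mem_iff_mem I hφ).mp hdet

end TransporterIdeal

section Division

variable {𝕜 E : Type*} [NontriviallyNormedField 𝕜] [NormedAddCommGroup E]
  [NormedSpace 𝕜 E]

/-- The terms of the power series of `(g w - g (w - ℓ w • e)) / ℓ w`, where `g` has the power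
series `P` at the origin. -/
noncomputable def FormalMultilinearSeries.shiftQuotient (P : FormalMultilinearSeries 𝕜 E 𝕜)
    (ℓ : E →L[𝕜] 𝕜) (e : E) : FormalMultilinearSeries 𝕜 E 𝕜 := fun m =>
  ∑ j : Fin (m + 1), ((P (m + 1)).compContinuousLinearMap fun i =>
    if i < j then ContinuousLinearMap.id 𝕜 E - ℓ.smulRight e
    else ContinuousLinearMap.id 𝕜 E).curryMid j e

namespace FormalMultilinearSeries

theorem mul_shiftQuotient_apply (P : FormalMultilinearSeries 𝕜 E 𝕜) (ℓ : E →L[𝕜] 𝕜) (e w : E)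
    (m : ℕ) : ℓ w * P.shiftQuotient ℓ e m (fun _ => w) =
      P (m + 1) (fun _ => w) - P (m + 1) (fun _ => w - ℓ w • e) := by
  let T : ℕ → 𝕜 := fun k => P (m + 1) fun i => if (i : ℕ) < k then w - ℓ w • e else w
  have hterm : ∀ j : Fin (m + 1), ℓ w * ((P (m + 1)).compContinuousLinearMap fun i =>
      if i < j then ContinuousLinearMap.id 𝕜 E - ℓ.smulRight e
      else ContinuousLinearMap.id 𝕜 E).curryMid j e (fun _ => w) = T j - T (j + 1) := by
    intro j
    let u : Fin (m + 1) → E := fun i => if i < j then w - ℓ w • e else w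
    have h1 : T j = P (m + 1) (Function.update u j w) := by
      refine congrArg _ (funext fun i => ?_)
      by_cases hi : i = j
      · subst hi
        simp
      · simp [u, hi]
    have h2 : T (j + 1) = P (m + 1) (Function.update u j (w - ℓ w • e)) := by
      refine congrArg _ (funext fun i => ?_)
      by_cases hi : i = j
      · subst hi
        simp
      · have : (i : ℕ) < j + 1 ↔ i < j := by
          rw [Fin.lt_def]
          have := Fin.val_ne_of_ne hi
          omega
        simp [u, hi, this]
    have h3 : ((P (m + 1)).compContinuousLinearMap fun i =>
        if i < j then ContinuousLinearMap.id 𝕜 E - ℓ.smulRight e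
        else ContinuousLinearMap.id 𝕜 E).curryMid j e (fun _ => w)
        = P (m + 1) (Function.update u j e) := by
      rw [ContinuousMultilinearMap.curryMid_apply,
        ContinuousMultilinearMap.compContinuousLinearMap_apply]
      refine congrArg _ (funext fun i => ?_)
      by_cases hi : i = j
      · subst hi
        simp
      · obtain ⟨l, rfl⟩ := Fin.exists_succAbove_eq hi
        by_cases hl : j.succAbove l < j
        · simp [u, hi, hl]
        · simp [u, hi, hl]
    rw [h1, h2, h3, ← ContinuousMultilinearMap.map_update_sub, sub_sub_cancel,
      ContinuousMultilinearMap.map_update_smul, smul_eq_mul]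
  rw [shiftQuotient, _root_.sum_apply, Finset.mul_sum,
    Finset.sum_congr rfl fun j _ => hterm j,
    Fin.sum_univ_eq_sum_range (fun k => T k - T (k + 1)) (m + 1), Finset.sum_range_sub']
  refine congrArg₂ _ (by simp [T]) (congrArg _ (funext fun i => ?_))
  rw [if_pos i.isLt]

theorem radius_shiftQuotient_pos (P : FormalMultilinearSeries 𝕜 E 𝕜) (hP : 0 < P.radius)
    (ℓ : E →L[𝕜] 𝕜) (e : E) : 0 < (P.shiftQuotient ℓ e).radius := by
  obtain ⟨C, a, hC, ha, hbound⟩ := P.le_mul_pow_of_radius_pos hP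
  set π : E →L[𝕜] E := ContinuousLinearMap.id 𝕜 E - ℓ.smulRight e with hπ
  let b : ℝ := 1 + ‖π‖
  have hb : 0 < b := by positivity
  have hnorm : ∀ m, ‖P.shiftQuotient ℓ e m‖ ≤ (m + 1) * (C * (a * b) ^ (m + 1) * ‖e‖) := by
    intro m
    have hterm : ∀ j ∈ (Finset.univ : Finset (Fin (m + 1))),
        ‖((P (m + 1)).compContinuousLinearMap fun i =>
          if i < j then π else ContinuousLinearMap.id 𝕜 E).curryMid j e‖
          ≤ C * (a * b) ^ (m + 1) * ‖e‖ := by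
      intro j _
      refine (ContinuousLinearMap.le_opNorm _ _).trans ?_
      rw [ContinuousMultilinearMap.norm_curryMid]
      refine mul_le_mul_of_nonneg_right ?_ (norm_nonneg e)
      refine (ContinuousMultilinearMap.norm_compContinuousLinearMap_le _ _).trans ?_
      rw [mul_pow, ← mul_assoc]
      refine mul_le_mul (hbound _) ?_ (Finset.prod_nonneg fun _ _ => norm_nonneg _) (by positivity)
      refine (Finset.prod_le_prod (g := fun _ => b) (fun _ _ => norm_nonneg _)
        fun i _ => ?_).trans (by simp)
      split_ifs
      · exact le_add_of_nonneg_left zero_le_one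
      · exact ContinuousLinearMap.norm_id_le.trans (le_add_of_nonneg_right (norm_nonneg _))
    refine (norm_sum_le_of_le _ hterm).trans (le_of_eq ?_)
    simp
  let r : NNReal := ⟨(2 * (a * b))⁻¹, by positivity⟩
  have hr : 0 < r := NNReal.coe_pos.mp (show 0 < (2 * (a * b))⁻¹ by positivity)
  refine lt_of_lt_of_le (ENNReal.coe_pos.mpr hr)
    (le_radius_of_bound _ (C * (a * b) * ‖e‖) fun m => ?_)
  have hrm : ((r : ℝ)) ^ m = ((2 : ℝ) ^ m)⁻¹ * ((a * b) ^ m)⁻¹ := by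
    rw [← mul_inv, ← mul_pow, ← inv_pow]
    rfl
  have hm : ((m : ℝ) + 1) ≤ 2 ^ m := by exact_mod_cast Nat.lt_two_pow_self
  calc ‖P.shiftQuotient ℓ e m‖ * (r : ℝ) ^ m
      ≤ (2 ^ m * (C * (a * b) ^ (m + 1) * ‖e‖)) * (r : ℝ) ^ m := by
        refine mul_le_mul_of_nonneg_right ((hnorm m).trans ?_) (by positivity)
        exact mul_le_mul_of_nonneg_right hm (by positivity)
    _ = C * (a * b) * ‖e‖ := by
        rw [hrm, pow_succ]
        field_simp

end FormalMultilinearSeries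

variable [CompleteSpace 𝕜]

theorem AnalyticAt.exists_sub_eq_mul_zero {g : E → 𝕜} (hg : AnalyticAt 𝕜 g 0) (ℓ : E →L[𝕜] 𝕜)
    (e : E) : ∃ q : E → 𝕜, AnalyticAt 𝕜 q 0 ∧
      ∀ᶠ w in 𝓝 0, g w - g (w - ℓ w • e) = ℓ w * q w := by
  obtain ⟨P, hP⟩ := hg
  have hQ := ((P.shiftQuotient ℓ e).hasFPowerSeriesOnBall
    (P.radius_shiftQuotient_pos hP.radius_pos ℓ e)).hasFPowerSeriesAt
  refine ⟨(P.shiftQuotient ℓ e).sum, hQ.analyticAt, ?_⟩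
  have hsum := hP.eventually_hasSum
  have hcont : Tendsto (fun w => w - ℓ w • e) (𝓝 (0 : E)) (𝓝 0) := by
    have : Continuous fun w => w - ℓ w • e := by fun_prop
    simpa using this.tendsto 0
  filter_upwards [hsum, hcont.eventually hsum, hQ.eventually_hasSum] with w h1 h2 h3
  rw [zero_add] at h1 h2 h3
  have h4 := (hasSum_nat_add_iff' 1).mpr (h1.sub h2)
  have h5 : HasSum (fun m => P (m + 1) (fun _ => w) - P (m + 1) (fun _ => w - ℓ w • e))
      (ℓ w * (P.shiftQuotient ℓ e).sum w) := by
    simpa only [P.mul_shiftQuotient_apply ℓ e w] using h3.mul_left (ℓ w)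
  have h6 : P 0 (fun _ => w) - P 0 (fun _ => w - ℓ w • e) = 0 :=
    sub_eq_zero.mpr (congrArg _ (Subsingleton.elim _ _))
  rw [← h4.unique h5, Finset.sum_range_one, h6, sub_zero]

/-- **Hadamard's lemma** for analytic functions: the difference of `g` and its pullback along
`w ↦ w - ℓ w • e` is divisible by `ℓ`. -/
theorem AnalyticAt.exists_sub_eq_mul {g : E → 𝕜} {z : E} (hg : AnalyticAt 𝕜 g z)
    (ℓ : E →L[𝕜] 𝕜) (hz : ℓ z = 0) (e : E) : ∃ q : E → 𝕜, AnalyticAt 𝕜 q z ∧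
      ∀ᶠ w in 𝓝 z, g w - g (w - ℓ w • e) = ℓ w * q w := by
  have hg' : AnalyticAt 𝕜 (fun v => g (v + z)) 0 :=
    AnalyticAt.fun_comp (by simpa using hg) (by fun_prop)
  obtain ⟨q, hq, hqw⟩ := hg'.exists_sub_eq_mul_zero ℓ e
  refine ⟨fun w => q (w - z), AnalyticAt.fun_comp (by simpa using hq) (by fun_prop), ?_⟩
  have htend : Tendsto (fun w : E => w - z) (𝓝 z) (𝓝 0) := by
    have : Continuous fun w : E => w - z := by fun_prop
    simpa using this.tendsto z
  filter_upwards [htend.eventually hqw] with w hw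
  have hℓ : ℓ (w - z) = ℓ w := by rw [map_sub, hz, sub_zero]
  rw [hℓ, sub_add_cancel, sub_right_comm, sub_add_cancel] at hw
  exact hw

end Division

namespace analyticGerms

variable {E : Type*} [NormedAddCommGroup E] [NormedSpace ℂ E] {z : E}

/-- The germ of an analytic function. -/
noncomputable def mk (g : E → ℂ) (hg : AnalyticAt ℂ g z) : analyticGerms E z := ⟨g, g, hg, rfl⟩

theorem exists_eq_mk (γ : analyticGerms E z) : ∃ g hg, γ = mk g hg := by
  obtain ⟨_, g, hg, rfl⟩ := γ
  exact ⟨g, hg, rfl⟩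

theorem mk_eq_mk_iff {g h : E → ℂ} {hg : AnalyticAt ℂ g z} {hh : AnalyticAt ℂ h z} :
    mk g hg = mk h hh ↔ g =ᶠ[𝓝 z] h :=
  Subtype.ext_iff.trans Filter.Germ.coe_eq

/-- Evaluation of germs at the base point. -/
noncomputable def eval (z : E) : analyticGerms E z →+* ℂ :=
  Filter.Germ.valueRingHom.comp (analyticGerms E z).subtype

theorem eval_mk {g : E → ℂ} (hg : AnalyticAt ℂ g z) : eval z (mk g hg) = g z := rfl

theorem isUnit_of_eval_ne_zero {γ : analyticGerms E z} (h : eval z γ ≠ 0) : IsUnit γ := by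
  obtain ⟨g, hg, rfl⟩ := exists_eq_mk γ
  rw [eval_mk] at h
  refine IsUnit.of_mul_eq_one (mk g⁻¹ (hg.inv h)) ?_
  change mk (g * g⁻¹) (hg.mul (hg.inv h)) = mk 1 analyticAt_const
  rw [mk_eq_mk_iff]
  filter_upwards [hg.continuousAt.eventually_ne h] with w hw
  exact mul_inv_cancel₀ hw

/-- Pullback of germs along a continuous linear map fixing the base point. -/
noncomputable def pullback (π : E →L[ℂ] E) (hπ : π z = z) :
    analyticGerms E z →+* analyticGerms E z where
  toFun γ := ⟨γ.1.compTendsto π (by simpa [hπ] using π.continuous.tendsto z), by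
    obtain ⟨_, g, hg, rfl⟩ := γ
    exact ⟨g ∘ π, AnalyticAt.comp (by rwa [hπ]) (π.analyticAt z), rfl⟩⟩
  map_one' := rfl
  map_zero' := rfl
  map_mul' := by
    rintro ⟨_, g, hg, rfl⟩ ⟨_, h, hh, rfl⟩
    rfl
  map_add' := by
    rintro ⟨_, g, hg, rfl⟩ ⟨_, h, hh, rfl⟩
    rfl

theorem pullback_mk (π : E →L[ℂ] E) (hπ : π z = z) {g : E → ℂ} (hg : AnalyticAt ℂ g z) :
    pullback π hπ (mk g hg) = mk (g ∘ π) (AnalyticAt.comp (by rwa [hπ]) (π.analyticAt z)) := rfl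

/-- The germ of a continuous linear functional. -/
noncomputable def ofDual (z : E) (ℓ : E →L[ℂ] ℂ) : analyticGerms E z := mk ℓ (ℓ.analyticAt z)

theorem eq_zero_of_mul_ofDual_eq_zero {ℓ : E →L[ℂ] ℂ} {e : E} (he : ℓ e = 1)
    {r : analyticGerms E z} (h : r * ofDual z ℓ = 0) : r = 0 := by
  obtain ⟨g, hg, rfl⟩ := exists_eq_mk r
  have h0 : ∀ᶠ w in 𝓝 z, g w * ℓ w = 0 :=
    mk_eq_mk_iff.mp (show mk (g * ⇑ℓ) (hg.mul (ℓ.analyticAt z)) = mk 0 analyticAt_const from h)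
  refine (mk_eq_mk_iff (hh := analyticAt_const)).mpr (show g =ᶠ[𝓝 z] fun _ => 0 from ?_)
  filter_upwards [h0.eventually_nhds, hg.eventually_continuousAt] with w hw hcont
  by_cases hℓ : ℓ w = 0
  · have hline : Tendsto (fun t : ℂ => w + t • e) (𝓝[≠] 0) (𝓝 w) := by
      have : Continuous fun t : ℂ => w + t • e := by fun_prop
      simpa using (this.tendsto 0).mono_left nhdsWithin_le_nhds
    have hzero : ∀ᶠ t in 𝓝[≠] (0 : ℂ), g (w + t • e) = 0 := by
      filter_upwards [hline.eventually hw, self_mem_nhdsWithin] with t ht ht0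
      refine (mul_eq_zero.mp ht).resolve_right ?_
      simpa [hℓ, he] using ht0
    exact tendsto_nhds_unique_of_eventuallyEq (hcont.tendsto.comp hline) tendsto_const_nhds hzero
  · exact (mul_eq_zero.mp hw.self_of_nhds).resolve_right hℓ

section Retraction

variable {ι : Type*} [DecidableEq ι] (ℓ : ι → E →L[ℂ] ℂ) (e : ι → E)

/-- For coordinates `ℓ i` vanishing at the base point there is an endomorphism of the ring of germs
setting the coordinates in `s` to zero, and fixing the other coordinates. -/
theorem exists_ringHom_sub_mem_span (hz : ∀ i, ℓ i z = 0)
    (he : ∀ i j, ℓ i (e j) = if i = j then 1 else 0) (s : Finset ι) :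
    ∃ σ : analyticGerms E z →+* analyticGerms E z,
      (∀ r, r - σ r ∈ Ideal.span ((fun i => ofDual z (ℓ i)) '' s)) ∧
      (∀ i ∈ s, σ (ofDual z (ℓ i)) = 0) ∧ ∀ a ∉ s, σ (ofDual z (ℓ a)) = ofDual z (ℓ a) := by
  induction s using Finset.induction_on with
  | empty => exact ⟨RingHom.id _, fun r => by simp, by simp, by simp⟩
  | insert b s hb ih =>
    obtain ⟨σ, hσ, hσ0, hσ1⟩ := ih
    let π : E →L[ℂ] E := ContinuousLinearMap.id ℂ E - (ℓ b).smulRight (e b)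
    have hπ : π z = z := by simp [π, hz]
    have hdual : ∀ i, pullback π hπ (ofDual z (ℓ i)) = if i = b then 0 else ofDual z (ℓ i) := by
      intro i
      rw [ofDual, pullback_mk]
      split_ifs with hi
      · subst hi
        refine (mk_eq_mk_iff (hh := analyticAt_const)).mpr (Eventually.of_forall fun w => ?_)
        simp [π, he]
      · refine mk_eq_mk_iff.mpr (Eventually.of_forall fun w => ?_)
        simp [π, he, hi]
    have hdiv : ∀ r, r - pullback π hπ r ∈ Ideal.span {ofDual z (ℓ b)} := by
      intro r
      obtain ⟨g, hg, rfl⟩ := exists_eq_mk r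
      obtain ⟨q, hq, hgq⟩ := hg.exists_sub_eq_mul (ℓ b) (hz b) (e b)
      refine Ideal.mem_span_singleton.mpr ⟨mk q hq, ?_⟩
      exact mk_eq_mk_iff (hg := hg.sub (AnalyticAt.comp (by rwa [hπ]) (π.analyticAt z)))
        (hh := ((ℓ b).analyticAt z).mul hq) |>.mpr hgq
    refine ⟨σ.comp (pullback π hπ), fun r => ?_, fun i hi => ?_, fun a ha => ?_⟩
    · rw [RingHom.comp_apply, ← sub_add_sub_cancel r (pullback π hπ r)]
      refine Ideal.add_mem _ (Ideal.span_mono ?_ (hdiv r)) (Ideal.span_mono ?_ (hσ _))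
      · rw [Set.singleton_subset_iff]
        exact ⟨b, by simp, rfl⟩
      · exact Set.image_mono (by simp)
    · rw [RingHom.comp_apply, hdual]
      split_ifs with hib
      · exact map_zero σ
      · exact hσ0 i ((Finset.mem_insert.mp hi).resolve_left hib)
    · rw [Finset.mem_insert, not_or] at ha
      rw [RingHom.comp_apply, hdual, if_neg ha.1, hσ1 a ha.2]

/-- The relations between coordinates vanishing at the base point are Koszul relations. -/
theorem mem_koszulRelations_of_dotProduct_ofDual_eq_zero [Fintype ι] (hz : ∀ i, ℓ i z = 0)
    (he : ∀ i j, ℓ i (e j) = if i = j then 1 else 0) {v : ι → analyticGerms E z}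
    (hv : v ⬝ᵥ (fun i => ofDual z (ℓ i)) = 0) :
    v ∈ koszulRelations fun i => ofDual z (ℓ i) := by
  refine mem_koszulRelations_of_dotProduct_eq_zero _ (fun s a ha r hr => ?_) hv
  obtain ⟨σ, hσ, hσ0, hσ1⟩ := exists_ringHom_sub_mem_span ℓ e hz he s
  have hker : Ideal.span ((fun i => ofDual z (ℓ i)) '' s) ≤ RingHom.ker σ := by
    refine Ideal.span_le.mpr ?_
    rintro _ ⟨i, hi, rfl⟩
    exact hσ0 i hi
  have hzero : σ r * ofDual z (ℓ a) = 0 := by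
    rw [← hσ1 a ha, ← map_mul]
    exact hker hr
  have := hσ r
  rwa [eq_zero_of_mul_ofDual_eq_zero (e := e a) (by simp [he]) hzero, sub_zero] at this

end Retraction

/-- The determinant of a matrix of germs is the germ of the pointwise determinant. -/
theorem coe_det_mk {n : ℕ} (a : Fin n → Fin n → E → ℂ) (ha : ∀ i j, AnalyticAt ℂ (a i j) z) :
    ((Matrix.of fun i j => mk (a i j) (ha i j)).det : Filter.Germ (𝓝 z) ℂ)
      = ((fun w => (Matrix.of fun i j => a i j w).det : E → ℂ) : Filter.Germ (𝓝 z) ℂ) := by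
  have hfun : (fun w => (Matrix.of fun i j => a i j w).det) = (Matrix.of a).det := by
    funext w
    exact ((Pi.evalRingHom (fun _ : E => ℂ) w).map_det (Matrix.of a)).symm
  rw [hfun]
  exact ((analyticGerms E z).subtype.map_det _).trans
    ((Filter.Germ.coeRingHom (R := ℂ) (𝓝 z)).map_det (Matrix.of a)).symm

end analyticGerms

theorem finrank_range_fderiv_eq_rank {n p : ℕ} {f : (Fin n → ℂ) → (Fin p → ℂ)}
    (hf : DifferentiableAt ℂ f 0) {α : Fin p → Fin n → ((Fin n → ℂ) × (Fin n → ℂ)) → ℂ}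
    (hα : ∀ j i, DifferentiableAt ℂ (α j i) (0, 0))
    (hrel : ∀ᶠ w : (Fin n → ℂ) × (Fin n → ℂ) in 𝓝 (0, 0),
      ∀ j, f w.1 j - f w.2 j = ∑ i, α j i w * (w.1 i - w.2 i)) :
    Module.finrank ℂ (LinearMap.range
        ((fderiv ℂ f 0 : (Fin n → ℂ) →L[ℂ] (Fin p → ℂ)) : (Fin n → ℂ) →ₗ[ℂ] (Fin p → ℂ)))
      = (Matrix.of fun j i => α j i (0, 0)).rank := by
  have hfderiv : ((fderiv ℂ f 0 : (Fin n → ℂ) →L[ℂ] (Fin p → ℂ)) :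
      (Fin n → ℂ) →ₗ[ℂ] (Fin p → ℂ)) = (Matrix.of fun j i => α j i (0, 0)).mulVecLin := by
    ext1 c
    ext j
    have hinl : Tendsto (fun x : Fin n → ℂ => (x, (0 : Fin n → ℂ))) (𝓝 0) (𝓝 (0, 0)) := by
      have : Continuous fun x : Fin n → ℂ => (x, (0 : Fin n → ℂ)) := by fun_prop
      exact this.tendsto 0
    have hev : (fun x => f x j) =ᶠ[𝓝 0] fun x => (∑ i, α j i (x, 0) * x i) + f 0 j := by
      filter_upwards [hinl.eventually hrel] with x hx
      have := hx j
      simp only [Pi.zero_apply, sub_zero] at this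
      rw [← this, sub_add_cancel]
    have hα' : ∀ i, DifferentiableAt ℂ (fun x : Fin n → ℂ => α j i (x, 0)) 0 := fun i =>
      DifferentiableAt.comp (g := α j i) 0 (hα j i) (by fun_prop)
    have hderiv : HasFDerivAt (fun x => f x j)
        (∑ i, α j i (0, 0) • (ContinuousLinearMap.proj i : (Fin n → ℂ) →L[ℂ] ℂ)) 0 := by
      refine HasFDerivAt.congr_of_eventuallyEq (HasFDerivAt.add_const (f 0 j)
        (HasFDerivAt.fun_sum fun i _ => ?_)) hev
      have := (hα' i).hasFDerivAt.mul (ContinuousLinearMap.proj (R := ℂ) (φ := fun _ => ℂ)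
        i).hasFDerivAt
      exact HasFDerivAt.congr_fderiv this (by simp)
    have hproj := hasFDerivAt_pi'.mp hf.hasFDerivAt j
    have heq := DFunLike.congr_fun (hproj.unique hderiv) (Pi.single c 1)
    simpa [Matrix.mulVec, dotProduct] using heq
  rw [hfderiv]
  rfl

section Generators

variable {n p : ℕ}

/-- The linear form `(x, x') ↦ xᵢ - x'ᵢ`. -/
noncomputable def coordDiff (i : Fin n) : (Fin n → ℂ) × (Fin n → ℂ) →L[ℂ] ℂ :=
  (ContinuousLinearMap.proj i).comp (ContinuousLinearMap.fst ℂ _ _) -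
    (ContinuousLinearMap.proj i).comp (ContinuousLinearMap.snd ℂ _ _)

theorem coordDiff_apply (i : Fin n) (w : (Fin n → ℂ) × (Fin n → ℂ)) :
    coordDiff i w = w.1 i - w.2 i := rfl

theorem sourceDiagIdeal_eq_span_range (n : ℕ) : sourceDiagIdeal n =
    Ideal.span (Set.range fun i : Fin n => analyticGerms.ofDual (0, 0) (coordDiff i)) := by
  refine congrArg Ideal.span (Set.ext fun γ => exists_congr fun i => ?_)
  rw [eq_comm, Subtype.ext_iff]
  rfl

variable {f : (Fin n → ℂ) → (Fin p → ℂ)} {α : Fin p → Fin n → ((Fin n → ℂ) × (Fin n → ℂ)) → ℂ}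
  (hα : ∀ j i, AnalyticAt ℂ (α j i) (0, 0))

open Matrix

/-- The matrix of germs of the entries of `α`. -/
noncomputable def germMatrix :
    Matrix (Fin p) (Fin n) (analyticGerms ((Fin n → ℂ) × (Fin n → ℂ)) (0, 0)) :=
  Matrix.of fun j i => analyticGerms.mk (α j i) (hα j i)

theorem coe_germMatrix_mulVec (hrel : ∀ᶠ w : (Fin n → ℂ) × (Fin n → ℂ) in 𝓝 (0, 0),
      ∀ j, f w.1 j - f w.2 j = ∑ i, α j i w * (w.1 i - w.2 i)) (j : Fin p) :
    ((germMatrix hα *ᵥ fun i => analyticGerms.ofDual (0, 0) (coordDiff i)) j :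
        Filter.Germ (𝓝 ((0, 0) : (Fin n → ℂ) × (Fin n → ℂ))) ℂ)
      = ((fun w : (Fin n → ℂ) × (Fin n → ℂ) => f w.1 j - f w.2 j) :
        Filter.Germ (𝓝 ((0, 0) : (Fin n → ℂ) × (Fin n → ℂ))) ℂ) := by
  have hsum : ((germMatrix hα *ᵥ fun i => analyticGerms.ofDual (0, 0) (coordDiff i)) j :
        Filter.Germ (𝓝 ((0, 0) : (Fin n → ℂ) × (Fin n → ℂ))) ℂ)
      = ((∑ i, α j i * ⇑(coordDiff i) : (Fin n → ℂ) × (Fin n → ℂ) → ℂ) :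
        Filter.Germ (𝓝 ((0, 0) : (Fin n → ℂ) × (Fin n → ℂ))) ℂ) :=
    (map_sum (analyticGerms _ _).subtype _ _).trans
      (map_sum (Filter.Germ.coeRingHom (R := ℂ) _) (fun i => α j i * ⇑(coordDiff i)) _).symm
  rw [hsum, Filter.Germ.coe_eq]
  filter_upwards [hrel] with w hw
  rw [hw j, Finset.sum_apply]
  rfl

theorem pullbackDiagIdeal_eq_span_range (hrel : ∀ᶠ w : (Fin n → ℂ) × (Fin n → ℂ) in 𝓝 (0, 0),
      ∀ j, f w.1 j - f w.2 j = ∑ i, α j i w * (w.1 i - w.2 i)) :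
    pullbackDiagIdeal n p f = Ideal.span (Set.range
      (germMatrix hα *ᵥ fun i => analyticGerms.ofDual (0, 0) (coordDiff i))) := by
  refine congrArg Ideal.span (Set.ext fun γ => exists_congr fun j => ?_)
  rw [eq_comm (b := γ), Subtype.ext_iff, coe_germMatrix_mulVec hα hrel]

theorem mondDoubleIdeal_eq_sup : mondDoubleIdeal n p f α = pullbackDiagIdeal n p f ⊔
    Ideal.span {γ | ∃ rows : Fin n → Fin p, StrictMono rows ∧
      γ = ((germMatrix hα).submatrix rows id).det} := by
  rw [mondDoubleIdeal, Ideal.span_union]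
  refine congrArg (pullbackDiagIdeal n p f ⊔ Ideal.span ·) (Set.ext fun γ => exists_congr
    fun rows => and_congr_right fun _ => ?_)
  rw [Subtype.ext_iff, ← analyticGerms.coe_det_mk _ fun i c => hα (rows i) c]
  rfl

end Generators

/-- Let `f : (ℂⁿ,0) → (ℂᵖ,0)` be a holomorphic map germ of corank `k`. Then Mond's
double point ideal `I²(f)` and the transporter ideal `H²(f) = P(f,2) : I_Δ` satisfy
`I²(f) ⊆ H²(f)` and `H²(f)ᵏ ⊆ I²(f)`. In particular, if `corank f = 1` then
`I²(f) = H²(f)`. -/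
theorem mondDoubleIdeal_le_colon_and_pow_le (n p k : ℕ) (hnp : n ≤ p) (hkn : k ≤ n)
    (f : (Fin n → ℂ) → (Fin p → ℂ)) (hf : AnalyticAt ℂ f 0) (hf0 : f 0 = 0)
    (hcorank : Module.finrank ℂ (LinearMap.range
        ((fderiv ℂ f 0 : (Fin n → ℂ) →L[ℂ] (Fin p → ℂ)) :
          (Fin n → ℂ) →ₗ[ℂ] (Fin p → ℂ))) = n - k)
    (α : Fin p → Fin n → ((Fin n → ℂ) × (Fin n → ℂ)) → ℂ)
    (hα : ∀ j i, AnalyticAt ℂ (α j i) (0, 0))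
    (hrelα : ∀ᶠ w : (Fin n → ℂ) × (Fin n → ℂ) in nhds (0, 0),
      ∀ j, f w.1 j - f w.2 j = ∑ i, α j i w * (w.1 i - w.2 i)) :
    mondDoubleIdeal n p f α ≤ (pullbackDiagIdeal n p f).colon (sourceDiagIdeal n) ∧
    ((pullbackDiagIdeal n p f).colon (sourceDiagIdeal n)) ^ k ≤ mondDoubleIdeal n p f α ∧
    (k = 1 → mondDoubleIdeal n p f α = (pullbackDiagIdeal n p f).colon (sourceDiagIdeal n)) := by
  set y : Fin n → analyticGerms ((Fin n → ℂ) × (Fin n → ℂ)) (0, 0) :=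
    fun i => analyticGerms.ofDual (0, 0) (coordDiff i)
  have hP := pullbackDiagIdeal_eq_span_range hα hrelα
  have hsup : mondDoubleIdeal n p f α = _ := mondDoubleIdeal_eq_sup hα
  have hle : mondDoubleIdeal n p f α ≤ (pullbackDiagIdeal n p f).colon (sourceDiagIdeal n) := by
    rw [hsup, sup_le_iff]
    refine ⟨Ideal.le_colon, Ideal.span_le.mpr ?_⟩
    rintro _ ⟨rows, -, rfl⟩
    rw [hP, sourceDiagIdeal_eq_span_range]
    exact Matrix.det_submatrix_mem_colon _ _ rows
  have hpow : ((pullbackDiagIdeal n p f).colon (sourceDiagIdeal n)) ^ k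
      ≤ mondDoubleIdeal n p f α := by
    rw [finrank_range_fderiv_eq_rank hf.differentiableAt
      (fun j i => (hα j i).differentiableAt) hrelα] at hcorank
    obtain ⟨φ, hφ, rfl⟩ := Matrix.exists_det_ne_zero_of_rank_eq hkn _ hcorank
    have hkoszul : ∀ v, v ⬝ᵥ y = 0 → v ∈ koszulRelations y := fun v hv =>
      analyticGerms.mem_koszulRelations_of_dotProduct_ofDual_eq_zero coordDiff
        (fun i => (Pi.single i 1, 0)) (fun i => by simp [coordDiff_apply])
        (fun i j => by simp [coordDiff_apply, Pi.single_apply]) hv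
    have hunit : IsUnit (Matrix.of fun i => Sum.elim (germMatrix hα)
        (fun c => Pi.single c 1) (φ i)).det := by
      refine analyticGerms.isUnit_of_eval_ne_zero ?_
      rw [RingHom.map_det]
      have hmat : (analyticGerms.eval (0, 0)).mapMatrix (Matrix.of fun i =>
          Sum.elim (germMatrix hα) (fun c => Pi.single c 1) (φ i)) = Matrix.of fun i =>
          Sum.elim (Matrix.of fun j i => α j i (0, 0)) (fun c => Pi.single c 1) (φ i) := by
        ext i c
        rw [RingHom.mapMatrix_apply, Matrix.map_apply, Matrix.of_apply, Matrix.of_apply]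
        rcases φ i with j | l
        · rfl
        · change analyticGerms.eval (0, 0) ((Pi.single l 1 : Fin n →
              analyticGerms ((Fin n → ℂ) × (Fin n → ℂ)) (0, 0)) c)
            = (Pi.single l 1 : Fin n → ℂ) c
          simp [Pi.single_apply, apply_ite]
      rw [hmat]
      exact hφ
    rw [hP, sourceDiagIdeal_eq_span_range]
    refine Matrix.colon_pow_le_of_minors_mem _ y hkoszul φ hunit _ ?_ fun rows hrows => ?_
    · rw [hsup, hP]
      exact le_sup_left
    · rw [hsup]
      exact Ideal.mem_sup_right (Ideal.subset_span ⟨rows, hrows, rfl⟩)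
  exact ⟨hle, hpow, fun hk => le_antisymm hle (by simpa [hk] using hpow)⟩
end
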